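/- arXiv:2007.03820 — 3 statements merged into one kernel-verified Lean document; each statement's English description precedes it below -/
import Mathlib

section
/- Let α > 0 and let V be a set of n vertices. If G and G' are graphs with V(G), V(G') ⊆ V and each having at least (5/9 + α)·n²/2 edges, then there are at least (α²/3)·n³ ordered triples (x, y, z) ∈ V³ such that xy and yz are edges of G, xy is an edge of G', deg_G(y) ≥ n/3, and deg_G(z) ≥ n/3. -/
set_option maxHeartbeats 1000000 in
/-- The polynomial core, normalized to `n = 1`. -/
lemma poly_core (α p b l pp pb pl bb bl ll : ℝ) (hα : 0 < α)
    (hp : 0 ≤ p) (hb : 0 ≤ b) (hl : 0 ≤ l) (hsum : p + b + l = 1)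
    (hpb : 0 ≤ pb) (hbb : 0 ≤ bb)
    (hα1 : 5 / 9 + α ≤ 1)
    (htot : 5 / 9 + α ≤ pp + bb + ll + 2 * pb + 2 * pl + 2 * bl)
    (hL : ll + bl + pl ≤ l / 3) (hB : bb + pb ≤ 2 * α / 3 * b)
    (hpp : pp ≤ p * p) (hpl : pl ≤ p * l) (hbl : bl ≤ b * l) (hll : ll ≤ l * l)
    (hcase : b = 0 ∨ 1 / 3 ≤ l + 2 * α / 3) :
    4 / 9 ≤ pp + 2 * pb + 2 * pl := by
  suffices hbad : ll + 2 * bl + bb ≤ 1 / 9 + α by linarith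
  have hbα : 0 ≤ α * b := by positivity
  have hppα : 0 ≤ α * p := by positivity
  have hlα : 0 ≤ α * l := by positivity
  -- sum of two bounds on the total
  have hs : 5 / 9 + α ≤ p * p + 4 * α / 3 * b + (p + b) * l + l / 3 := by nlinarith
  have hf : ll + 2 * bl + bb ≤ p * p + 4 * α / 3 * b + 2 * l / 3 - 5 / 9 - α + 2 * (b * l) := by
    nlinarith
  have hb34 : b ≤ 3 / 4 := by
    by_contra h
    push Not at h
    have h1 : p * p ≤ 1 / 16 := by nlinarith
    have h2 : (p + b) * l + l / 3 ≤ 3 / 16 + 1 / 12 := by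
      have : p + b = 1 - l := by linarith
      rw [this]; nlinarith
    have h3 : α * b ≤ α := by nlinarith
    nlinarith
  have hq : 1 / 9 + (l - 2 / 3) ^ 2 ≤ p * p := by
    have h3 : α * b ≤ α * (3 / 4) := by nlinarith
    have : p + b = 1 - l := by linarith
    rw [this] at hs
    nlinarith
  have hp13 : 1 / 3 ≤ p := by nlinarith [sq_nonneg (l - 2 / 3)]
  have hbe : b = 1 - l - p := by linarith
  have hfin : 1 / 3 ≤ l + 2 * α / 3 → ll + 2 * bl + bb ≤ 1 / 9 + α := by
    intro hc
    refine hf.trans ?_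
    have h3 : α * b ≤ α * (2 / 3) := by nlinarith
    -- chord bound: p^2 ≤ (1/3 + (1-l)) p - (1-l)/3
    have hch : (p - 1 / 3) * (1 - l - p) ≥ 0 := mul_nonneg (by linarith) (by linarith)
    have hmain : p * p + 2 * l / 3 + 2 * (b * l) - 5 / 9 ≤ 1 / 9 + 10 / 9 * α := by
      have hpl1 : p ≤ 1 - l := by linarith
      have hl1 : l ≤ 1 := by linarith
      have hend : (l - 1 / 3) * (l - 1) ≤ 10 / 9 * α := by
        rcases le_total (1 / 3) l with h | h
        · have := mul_nonneg (sub_nonneg.2 h) (sub_nonneg.2 hl1)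
          linarith
        · have h5 : (1 / 3 - l) * (1 - l) ≤ (2 * α / 3) * 1 :=
            mul_le_mul (by linarith) (by linarith) (by linarith) (by linarith)
          linarith
      rw [hbe]
      rcases le_total 0 (4 / 3 - 3 * l) with h | h
      · have := mul_nonneg h (sub_nonneg.2 hpl1)
        linarith
      · have := mul_nonneg (neg_nonneg.2 h) (sub_nonneg.2 hp13)
        have := sq_nonneg (l - 1 / 2)
        linarith
    linarith
  rcases hcase with h0 | hc
  · by_cases hl3 : 1 / 3 ≤ l
    · exact hfin (by linarith)
    · have : bl ≤ 0 := by rw [h0] at hbl; linarith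
      have : bb ≤ 0 := by rw [h0] at hB; linarith
      have hl3' : l ≤ 1 / 3 := (not_le.1 hl3).le
      have : l * l ≤ 1 / 3 * (1 / 3) := mul_le_mul hl3' hl3' hl (by norm_num)
      linarith
  · exact hfin hc

/-- The polynomial core, scaled. -/
lemma poly_core_scaled (N α p b l pp pb pl bb bl ll : ℝ) (hN : 0 < N) (hα : 0 < α)
    (hp : 0 ≤ p) (hb : 0 ≤ b) (hl : 0 ≤ l) (hsum : p + b + l = N)
    (hpb : 0 ≤ pb) (hbb : 0 ≤ bb)
    (hα1 : (5 / 9 + α) * N ^ 2 ≤ N ^ 2)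
    (htot : (5 / 9 + α) * N ^ 2 ≤ pp + bb + ll + 2 * pb + 2 * pl + 2 * bl)
    (hL : ll + bl + pl ≤ l * (N / 3)) (hB : bb + pb ≤ b * (2 * α / 3 * N))
    (hpp : pp ≤ p * p) (hpl : pl ≤ p * l) (hbl : bl ≤ b * l) (hll : ll ≤ l * l)
    (hcase : b = 0 ∨ N / 3 ≤ l + 2 * α / 3 * N) :
    4 / 9 * N ^ 2 ≤ pp + 2 * pb + 2 * pl := by
  have hN2 : 0 < N ^ 2 := by positivity
  have sc : ∀ x : ℝ, x = x / N * N := fun x => by field_simp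
  have sc2 : ∀ x : ℝ, x = x / N ^ 2 * N ^ 2 := fun x => by field_simp
  have cancel : ∀ x y : ℝ, x * N ^ 2 ≤ y * N ^ 2 → x ≤ y := fun x y h =>
    le_of_mul_le_mul_right h hN2
  have ep := sc p
  have eb := sc b
  have el := sc l
  have epp := sc2 pp
  have epb := sc2 pb
  have epl := sc2 pl
  have ebb := sc2 bb
  have ebl := sc2 bl
  have ell := sc2 ll
  have hp1 : 0 ≤ p / N := by positivity
  have hb1 : 0 ≤ b / N := by positivity
  have hl1 : 0 ≤ l / N := by positivity
  have hpb1 : 0 ≤ pb / N ^ 2 := by positivity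
  have hbb1 : 0 ≤ bb / N ^ 2 := by positivity
  generalize p / N = p' at *
  generalize b / N = b' at *
  generalize l / N = l' at *
  generalize pp / N ^ 2 = pp' at *
  generalize pb / N ^ 2 = pb' at *
  generalize pl / N ^ 2 = pl' at *
  generalize bb / N ^ 2 = bb' at *
  generalize bl / N ^ 2 = bl' at *
  generalize ll / N ^ 2 = ll' at *
  subst ep eb el epp epb epl ebb ebl ell
  have key := poly_core α p' b' l' pp' pb' pl' bb' bl' ll' hα hp1 hb1 hl1
    (mul_right_cancel₀ hN.ne' (by linarith)) hpb1 hbb1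
    (cancel _ _ (by linarith)) (cancel _ _ (by linarith)) (cancel _ _ (by linarith))
    (cancel _ _ (by linarith)) (cancel _ _ (by linarith)) (cancel _ _ (by linarith))
    (cancel _ _ (by linarith)) (cancel _ _ (by linarith))
    (hcase.imp (fun h => (mul_eq_zero.1 h).resolve_right hN.ne')
      (fun h => le_of_mul_le_mul_right (by linarith) hN))
  have := mul_le_mul_of_nonneg_right key hN2.le
  linarith

open Finset in
lemma weighted_core {V : Type*} [Fintype V] [DecidableEq V] (N α : ℝ) (hN : (Fintype.card V : ℝ) = N)
    (hNpos : 0 < N) (hα : 0 < α) (g g' : V → V → ℝ)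
    (g0 : ∀ x y, 0 ≤ g x y) (g1 : ∀ x y, g x y ≤ 1) (gs : ∀ x y, g x y = g y x)
    (g0' : ∀ x y, 0 ≤ g' x y) (g1' : ∀ x y, g' x y ≤ 1) (gs' : ∀ x y, g' x y = g' y x)
    (hE : (5 / 9 + α) * N ^ 2 ≤ ∑ x, ∑ y, g x y)
    (hE' : (5 / 9 + α) * N ^ 2 ≤ ∑ x, ∑ y, g' x y)
    (H : Finset V) (hH : ∀ y, y ∈ H ↔ N / 3 ≤ ∑ x, g y x) :
    α ^ 2 / 3 * N ^ 3 ≤ ∑ y ∈ H, (∑ x, g y x * g' y x) * (∑ z ∈ H, g y z) := by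
  set P := H.filter (fun y => 2 * α / 3 * N ≤ ∑ z ∈ H, g y z) with hP
  set B := H.filter (fun y => ¬ 2 * α / 3 * N ≤ ∑ z ∈ H, g y z) with hB
  set L := Hᶜ with hLdef
  let e : Finset V → Finset V → ℝ := fun S T => ∑ x ∈ S, ∑ y ∈ T, g x y
  have splitH : ∀ f : V → ℝ, ∑ x ∈ H, f x = ∑ x ∈ P, f x + ∑ x ∈ B, f x := fun f =>
    (Finset.sum_filter_add_sum_filter_not _ _ _).symm
  have splitU : ∀ f : V → ℝ, ∑ x, f x = ∑ x ∈ P, f x + ∑ x ∈ B, f x + ∑ x ∈ L, f x := fun f => by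
    rw [← splitH, Finset.sum_add_sum_compl]
  have esymm : ∀ S T, e S T = e T S := fun S T => by
    simp only [e]
    rw [Finset.sum_comm]
    exact Finset.sum_congr rfl fun _ _ => Finset.sum_congr rfl fun _ _ => gs _ _
  have e0 : ∀ S T, 0 ≤ e S T := fun S T =>
    Finset.sum_nonneg fun _ _ => Finset.sum_nonneg fun _ _ => g0 _ _
  have e1 : ∀ S T, e S T ≤ (#S : ℝ) * #T := fun S T => by
    calc e S T ≤ ∑ x ∈ S, ∑ y ∈ T, (1 : ℝ) :=
          Finset.sum_le_sum fun _ _ => Finset.sum_le_sum fun _ _ => g1 _ _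
      _ = _ := by simp
  have hcard : (#P : ℝ) + #B + #L = N := by
    have := splitU (fun _ => 1)
    simp at this
    linarith
  have htot : ∑ x, ∑ y, g x y = e P P + e B B + e L L + 2 * e P B + 2 * e P L + 2 * e B L := by
    rw [splitU]
    simp only [splitU, Finset.sum_add_distrib]
    change e P P + e P B + e P L + (e B P + e B B + e B L) + (e L P + e L B + e L L) = _
    rw [esymm B P, esymm L P, esymm L B]; ring
  have hLb : e L L + e B L + e P L ≤ #L * (N / 3) := by
    have : e L L + e B L + e P L = ∑ x ∈ L, ∑ y, g x y := by
      simp only [splitU, Finset.sum_add_distrib]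
      change _ = e L P + e L B + e L L
      rw [esymm L P, esymm L B]; ring
    rw [this, ← nsmul_eq_mul]
    refine Finset.sum_le_card_nsmul _ _ _ fun x hx => ?_
    have : x ∉ H := by simpa [hLdef] using hx
    rw [hH] at this
    linarith
  have hBb : e B B + e P B ≤ #B * (2 * α / 3 * N) := by
    have : e B B + e P B = ∑ x ∈ B, ∑ y ∈ H, g x y := by
      simp only [splitH, Finset.sum_add_distrib]
      change _ = e B P + e B B
      rw [esymm B P]; ring
    rw [this, ← nsmul_eq_mul]
    refine Finset.sum_le_card_nsmul _ _ _ fun x hx => ?_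
    have := (Finset.mem_filter.1 hx).2
    linarith
  have hcase : (#B : ℝ) = 0 ∨ N / 3 ≤ #L + 2 * α / 3 * N := by
    rcases B.eq_empty_or_nonempty with h | ⟨y, hy⟩
    · left; simp [h]
    · right
      obtain ⟨h1, h2⟩ := Finset.mem_filter.1 hy
      have h3 := (hH y).1 h1
      rw [splitU, ← splitH] at h3
      have h4 : ∑ x ∈ L, g y x ≤ #L := by
        calc _ ≤ ∑ x ∈ L, (1 : ℝ) := Finset.sum_le_sum fun _ _ => g1 _ _
          _ = _ := by simp
      linarith
  have htot1 : ∑ x, ∑ y, g x y ≤ N ^ 2 := by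
    have := e1 univ univ
    simp only [Finset.card_univ, hN] at this
    calc _ ≤ _ := this
      _ = _ := by ring
  have hgood : 4 / 9 * N ^ 2 ≤ e P P + 2 * e P B + 2 * e P L := by
    refine poly_core_scaled N α #P #B #L _ _ _ _ _ _ hNpos hα (Nat.cast_nonneg _)
      (Nat.cast_nonneg _) (Nat.cast_nonneg _) hcard (e0 _ _) (e0 _ _) (hE.trans htot1) (htot ▸ hE)
      hLb hBb (e1 _ _) (e1 _ _) (e1 _ _) (e1 _ _) hcase
  -- pass to the intersection
  set M := ∑ y ∈ P, ∑ x, g y x * g' y x with hM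
  have hM2 : α * N ^ 2 ≤ 2 * M := by
    have split2 : ∀ f : V → ℝ, ∑ x, f x = ∑ x ∈ P, f x + ∑ x ∈ Pᶜ, f x := fun f => by
      rw [Finset.sum_add_sum_compl]
    have k1 : ∑ y ∈ P, ∑ x, (g y x + g' y x - 1) ≤ M :=
      Finset.sum_le_sum fun y _ => Finset.sum_le_sum fun x _ => by
        nlinarith [g1 y x, g1' y x]
    have k2 : ∑ y ∈ P, ∑ x ∈ Pᶜ, (g y x + g' y x - 1) ≤ M :=
      Finset.sum_le_sum fun y _ => by
        calc _ ≤ ∑ x ∈ Pᶜ, g y x * g' y x := Finset.sum_le_sum fun x _ => by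
              nlinarith [g1 y x, g1' y x]
          _ ≤ _ := Finset.sum_le_univ_sum_of_nonneg fun x => mul_nonneg (g0 _ _) (g0' _ _)
    have k3 : ∑ x ∈ Pᶜ, ∑ y ∈ Pᶜ, (g' x y - 1) ≤ 0 :=
      Finset.sum_nonpos fun x _ => Finset.sum_nonpos fun y _ => by linarith [g1' x y]
    have k4 : ∑ x, ∑ y, (g' x y - 1) = ∑ x, ∑ y, g' x y - N ^ 2 := by
      simp only [Finset.sum_sub_distrib]
      simp [hN, sq]
    have k5 : ∑ x, ∑ y, (g' x y - 1) = ∑ x ∈ P, ∑ y, (g' x y - 1) +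
        ∑ x ∈ P, ∑ y ∈ Pᶜ, (g' x y - 1) + ∑ x ∈ Pᶜ, ∑ y ∈ Pᶜ, (g' x y - 1) := by
      rw [split2]
      have : ∑ x ∈ Pᶜ, ∑ y, (g' x y - 1) =
          ∑ x ∈ Pᶜ, ∑ y ∈ P, (g' x y - 1) + ∑ x ∈ Pᶜ, ∑ y ∈ Pᶜ, (g' x y - 1) := by
        rw [← Finset.sum_add_distrib]
        exact Finset.sum_congr rfl fun x _ => split2 _
      rw [this, Finset.sum_comm (s := Pᶜ) (t := P)]
      rw [add_assoc]
      congr 2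
      exact Finset.sum_congr rfl fun _ _ => Finset.sum_congr rfl fun _ _ => by rw [gs']
    have k6 : ∑ y ∈ P, ∑ x, g y x = e P P + e P B + e P L := by
      simp only [splitU, Finset.sum_add_distrib]; rfl
    have k7 : ∑ y ∈ P, ∑ x ∈ Pᶜ, g y x = e P B + e P L := by
      have : ∑ y ∈ P, ∑ x, g y x = e P P + ∑ y ∈ P, ∑ x ∈ Pᶜ, g y x := by
        simp only [split2, Finset.sum_add_distrib]; rfl
      linarith
    have k8 : ∑ y ∈ P, ∑ x, (g y x + g' y x - 1) =
        ∑ y ∈ P, ∑ x, g y x + ∑ y ∈ P, ∑ x, (g' y x - 1) := by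
      simp only [add_sub_assoc, Finset.sum_add_distrib]
    have k9 : ∑ y ∈ P, ∑ x ∈ Pᶜ, (g y x + g' y x - 1) =
        ∑ y ∈ P, ∑ x ∈ Pᶜ, g y x + ∑ y ∈ P, ∑ x ∈ Pᶜ, (g' y x - 1) := by
      simp only [add_sub_assoc, Finset.sum_add_distrib]
    linarith
  have hd0 : ∀ y, 0 ≤ ∑ x, g y x * g' y x := fun y =>
    Finset.sum_nonneg fun x _ => mul_nonneg (g0 _ _) (g0' _ _)
  calc α ^ 2 / 3 * N ^ 3 = (α * N ^ 2) / 2 * (2 * α / 3 * N) := by ring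
    _ ≤ M * (2 * α / 3 * N) := by gcongr; linarith
    _ = ∑ y ∈ P, (∑ x, g y x * g' y x) * (2 * α / 3 * N) := by rw [hM, Finset.sum_mul]
    _ ≤ ∑ y ∈ P, (∑ x, g y x * g' y x) * (∑ z ∈ H, g y z) :=
        Finset.sum_le_sum fun y hy =>
          mul_le_mul_of_nonneg_left (Finset.mem_filter.1 hy).2 (hd0 y)
    _ ≤ _ := Finset.sum_le_sum_of_subset_of_nonneg (Finset.filter_subset _ _) fun y _ _ =>
        mul_nonneg (hd0 y) (Finset.sum_nonneg fun _ _ => g0 _ _)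

open Classical in
lemma sum_adj_eq {V : Type*} [Fintype V] (G : SimpleGraph V) (y : V) :
    ∑ x, (if G.Adj y x then (1 : ℝ) else 0) = ((G.neighborSet y).ncard : ℝ) := by
  rw [Finset.sum_boole, Set.ncard_eq_toFinset_card']
  congr 2
  ext x; simp

open Classical in
lemma sum_sum_adj_eq {V : Type*} [Fintype V] (G : SimpleGraph V) :
    ∑ y, ∑ x, (if G.Adj y x then (1 : ℝ) else 0) = 2 * (G.edgeSet.ncard : ℝ) := by
  have h := G.sum_degrees_eq_twice_card_edges
  have h2 : G.edgeSet.ncard = G.edgeFinset.card := by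
    rw [← SimpleGraph.coe_edgeFinset, Set.ncard_coe_finset]
  rw [h2]
  have : ((∑ v, G.degree v : ℕ) : ℝ) = ((2 * G.edgeFinset.card : ℕ) : ℝ) := by rw [h]
  push_cast at this
  rw [← this]
  refine Finset.sum_congr rfl fun y _ => ?_
  rw [Finset.sum_boole, ← SimpleGraph.card_neighborFinset_eq_degree]
  congr 2
  ext x; simp


/-- Corollary 2.3: two graphs on (subsets of) an `n`-set `V`, each with at least
`(5/9 + α) n²/2` edges, admit at least `(α²/3) n³` triples `(x, y, z)` such that `xyz` is a
walk in `G`, `xy ∈ E(G')`, and `y`, `z` have `G`-degree at least `n/3`. -/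
theorem stmt1 {V : Type*} [Fintype V] (n : ℕ) (hn : Fintype.card V = n)
    (α : ℝ) (hα : 0 < α) (G G' : SimpleGraph V)
    (hE : (5 / 9 + α) * (n : ℝ) ^ 2 / 2 ≤ (G.edgeSet.ncard : ℝ))
    (hE' : (5 / 9 + α) * (n : ℝ) ^ 2 / 2 ≤ (G'.edgeSet.ncard : ℝ)) :
    α ^ 2 / 3 * (n : ℝ) ^ 3 ≤
      (({p : V × V × V | G.Adj p.1 p.2.1 ∧ G.Adj p.2.1 p.2.2 ∧ G'.Adj p.1 p.2.1 ∧
          (n : ℝ) / 3 ≤ ((G.neighborSet p.2.1).ncard : ℝ) ∧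
          (n : ℝ) / 3 ≤ ((G.neighborSet p.2.2).ncard : ℝ)} : Set (V × V × V)).ncard : ℝ) := by
  classical
  rcases Nat.eq_zero_or_pos n with h0 | hpos
  · subst h0
    simp
  have hN : (0 : ℝ) < n := by exact_mod_cast hpos
  let H : Finset V := Finset.univ.filter fun y => (n : ℝ) / 3 ≤ ((G.neighborSet y).ncard : ℝ)
  have key := weighted_core (V := V) (n : ℝ) α (by rw [hn]) hN hα
    (fun x y => if G.Adj x y then 1 else 0) (fun x y => if G'.Adj x y then 1 else 0)
    (fun x y => by split_ifs <;> norm_num)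
    (fun x y => by split_ifs <;> norm_num)
    (fun x y => by simp only [G.adj_comm])
    (fun x y => by split_ifs <;> norm_num)
    (fun x y => by split_ifs <;> norm_num)
    (fun x y => by simp only [G'.adj_comm])
    (by rw [sum_sum_adj_eq]; linarith) (by rw [sum_sum_adj_eq]; linarith)
    H (fun y => by rw [sum_adj_eq]; simp [H])
  refine key.trans (le_of_eq ?_)
  have hset : ({p : V × V × V | G.Adj p.1 p.2.1 ∧ G.Adj p.2.1 p.2.2 ∧ G'.Adj p.1 p.2.1 ∧
          (n : ℝ) / 3 ≤ ((G.neighborSet p.2.1).ncard : ℝ) ∧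
          (n : ℝ) / 3 ≤ ((G.neighborSet p.2.2).ncard : ℝ)} : Set (V × V × V)) =
      ((Finset.univ.filter fun p : V × V × V => G.Adj p.1 p.2.1 ∧ G.Adj p.2.1 p.2.2 ∧
          G'.Adj p.1 p.2.1 ∧ p.2.1 ∈ H ∧ p.2.2 ∈ H : Finset (V × V × V)) : Set (V × V × V)) := by
    ext p; simp [H]
  rw [hset, Set.ncard_coe_finset, ← Finset.sum_boole, Fintype.sum_prod_type]
  simp only [Fintype.sum_prod_type]
  rw [Finset.sum_comm, ← Finset.sum_filter_add_sum_filter_not Finset.univ (· ∈ H),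
    Finset.sum_eq_zero (s := Finset.univ.filter (· ∉ H)), add_zero, Finset.filter_mem_eq_inter,
    Finset.univ_inter]
  · refine Finset.sum_congr rfl fun y hy => ?_
    rw [Finset.sum_mul]
    refine Finset.sum_congr rfl fun x _ => ?_
    rw [Finset.mul_sum, ← Finset.sum_filter_add_sum_filter_not Finset.univ (· ∈ H),
      Finset.sum_eq_zero (s := Finset.univ.filter (· ∉ H)), add_zero, Finset.filter_mem_eq_inter,
      Finset.univ_inter]
    · refine Finset.sum_congr rfl fun z hz => ?_
      simp only [hy, hz, G.adj_comm y x, G'.adj_comm y x]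
      by_cases h1 : G.Adj x y <;> by_cases h2 : G'.Adj x y <;> by_cases h3 : G.Adj y z <;>
        simp [h1, h2, h3]
    · intro z hz
      have hz' := (Finset.mem_filter.1 hz).2
      simp [hz']
  · intro y hy
    have hy' := (Finset.mem_filter.1 hy).2
    simp [hy']
end

section
/- For all k ≥ 2 and α, μ > 0 there exist β > 0 and an odd integer ℓ ≥ 3 such that for all sufficiently large n, every k-uniform hypergraph H on n vertices with δ_{k−2}(H) ≥ (5/9 + α)·n²/2 can be expanded to an (α, β, ℓ, μ)-constellation, i.e., one can choose induced subgraphs R_x ⊆ H_x for all (k−2)-element sets x such that the resulting constellation is an (α, β, ℓ, μ)-constellation. -/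
open Finset

structure Constellation (V : Type*) [DecidableEq V] where
  verts : Finset V
  edges : Finset (Finset V)
  W : Finset V → Finset V

namespace Constellation

variable {V : Type*} [DecidableEq V]

/-- The link constellation `Ψ_S`. -/
def link (Ψ : Constellation V) (S : Finset V) : Constellation V where
  verts := Ψ.verts \ S
  edges := (Ψ.edges.filter fun e => S ⊆ e).image (· \ S)
  W := fun x => Ψ.W (x ∪ S) \ S

/-- The induced subconstellation `Ψ[X]`. -/
def induce (Ψ : Constellation V) (X : Finset V) : Constellation V where
  verts := Ψ.verts ∩ X
  edges := Ψ.edges.filter fun e => e ⊆ X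
  W := fun x => Ψ.W x ∩ X

/-- `Ψ - X`. -/
def remove (Ψ : Constellation V) (X : Finset V) : Constellation V :=
  Ψ.induce (Ψ.verts \ X)

end Constellation

/-- `Ψ` is a `k`-uniform constellation. -/
def IsUniformConst {V : Type*} [DecidableEq V] (k : ℕ) (Ψ : Constellation V) : Prop :=
  ∀ e ∈ Ψ.edges, e ⊆ Ψ.verts ∧ e.card = k

/-- `ζ`-leftconnectability of a `(k-1)`-tuple (as a list) in a `k`-uniform constellation. -/
def LeftConn {V : Type*} [DecidableEq V] : ℕ → Constellation V → ℝ → List V → Prop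
  | 0, _, _, _ => False
  | 1, _, _, _ => False
  | 2, Ψ, _, xs => xs.length = 1 ∧ ∀ v ∈ xs, v ∈ Ψ.W ∅
  | (k + 3), Ψ, ζ, xs =>
      xs.length = k + 2 ∧
      ζ * (Ψ.verts.card : ℝ) ≤
        (({z : V | z ∈ Ψ.verts ∧ insert z xs.toFinset ∈ Ψ.edges ∧
            LeftConn (k + 2) (Ψ.link {z}) ζ xs.tail} : Set V).ncard : ℝ)

def RightConn {V : Type*} [DecidableEq V] (k : ℕ) (Ψ : Constellation V) (ζ : ℝ)
    (xs : List V) : Prop :=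
  LeftConn k Ψ ζ xs.reverse

def Conn {V : Type*} [DecidableEq V] (k : ℕ) (Ψ : Constellation V) (ζ : ℝ)
    (xs : List V) : Prop :=
  LeftConn k Ψ ζ xs ∧ RightConn k Ψ ζ xs

/-- A `ζ`-bridge. -/
def IsBridge {V : Type*} [DecidableEq V] (k : ℕ) (Ψ : Constellation V) (ζ : ℝ)
    (x : Fin k → V) : Prop :=
  Finset.image x Finset.univ ∈ Ψ.edges ∧
  RightConn k Ψ ζ (List.ofFn x).dropLast ∧
  LeftConn k Ψ ζ (List.ofFn x).tail

/-- number of edges of the link graph of `x` crossing between `V(R_x)` and its complement. -/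
def crossCount {V : Type*} [DecidableEq V] (Ψ : Constellation V) (x : Finset V) : ℕ :=
  ((Ψ.link x).edges.filter fun p => (p ∩ Ψ.W x).Nonempty ∧ (p \ Ψ.W x).Nonempty).card

/-- `Ψ` is an `(α, μ)`-constellation. -/
def IsAMConst {V : Type*} [DecidableEq V] (k : ℕ) (Ψ : Constellation V) (α μ : ℝ) : Prop :=
  IsUniformConst k Ψ ∧
  ∀ x : Finset V, x ⊆ Ψ.verts → x.card = k - 2 →
    ((5 / 9 + α) * (Ψ.verts.card : ℝ) ^ 2 / 2 ≤
        ((Ψ.edges.filter fun e => x ⊆ e).card : ℝ)) ∧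
    Ψ.W x ⊆ Ψ.verts ∧
    ((2 / 3 + α / 2) * (Ψ.verts.card : ℝ) ≤ ((Ψ.W x).card : ℝ)) ∧
    ((crossCount Ψ x : ℝ) ≤ μ * (Ψ.verts.card : ℝ) ^ 2)

/-- number of `y`-`z`-paths of length `ℓ` in `R_x`. -/
noncomputable def pathCount {V : Type*} [DecidableEq V] (Ψ : Constellation V) (x : Finset V)
    (y z : V) (ℓ : ℕ) : ℕ :=
  ({ l : List V | l.length = ℓ + 1 ∧ l.Nodup ∧ (∀ v ∈ l, v ∈ Ψ.W x) ∧
      l.head? = some y ∧ l.getLast? = some z ∧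
      l.Chain' (fun u v => ({u, v} : Finset V) ∈ (Ψ.link x).edges) } : Set (List V)).ncard

/-- `Ψ` is an `(α, β, ℓ, μ)`-constellation. -/
def IsConst {V : Type*} [DecidableEq V] (k : ℕ) (Ψ : Constellation V)
    (α β : ℝ) (ℓ : ℕ) (μ : ℝ) : Prop :=
  IsAMConst k Ψ α μ ∧
  ∀ x : Finset V, x ⊆ Ψ.verts → x.card = k - 2 →
    ∀ y ∈ Ψ.W x, ∀ z ∈ Ψ.W x, y ≠ z →
      β * (Ψ.verts.card : ℝ) ^ (ℓ - 1) ≤ (pathCount Ψ x y z ℓ : ℝ)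

/-- `x` is a walk (of `m` vertices) in the `k`-uniform hypergraph with edge set `E`. -/
def IsWalk {V : Type*} [DecidableEq V] (E : Finset (Finset V)) (k m : ℕ)
    (x : Fin m → V) : Prop :=
  ∀ i : ℕ, ∀ h : i + k ≤ m,
    Finset.image (fun j : Fin k => x ⟨i + j.1, by have := j.2; omega⟩) Finset.univ ∈ E

/-- `l` is a path in the `k`-uniform hypergraph with edge set `E`. -/
def IsPathList {V : Type*} [DecidableEq V] (E : Finset (Finset V)) (k : ℕ)
    (l : List V) : Prop :=
  l.Nodup ∧ ∀ i : ℕ, i + k ≤ l.length → ((l.drop i).take k).toFinset ∈ E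

set_option linter.unusedSectionVars false

/-- weighted edge count -/
noncomputable def eW {V : Type*} (a : V → V → ℝ) (S T : Finset V) : ℝ :=
  ∑ u ∈ S, ∑ v ∈ T, a u v

section eWsec
variable {V : Type*} [DecidableEq V] {a : V → V → ℝ}

lemma eW_comm (hs : ∀ u v, a u v = a v u) (S T : Finset V) : eW a S T = eW a T S := by
  unfold eW
  rw [Finset.sum_comm]
  exact Finset.sum_congr rfl fun u _ => Finset.sum_congr rfl fun v _ => hs v u

lemma eW_union_left {S S' : Finset V} (h : Disjoint S S') (T : Finset V) :
    eW a (S ∪ S') T = eW a S T + eW a S' T := by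
  unfold eW; rw [Finset.sum_union h]

lemma eW_union_right {S S' : Finset V} (h : Disjoint S S') (T : Finset V) :
    eW a T (S ∪ S') = eW a T S + eW a T S' := by
  unfold eW; rw [← Finset.sum_add_distrib]
  exact Finset.sum_congr rfl fun u _ => Finset.sum_union h

lemma eW_nonneg (h0 : ∀ u v, 0 ≤ a u v) (S T : Finset V) : 0 ≤ eW a S T :=
  Finset.sum_nonneg fun u _ => Finset.sum_nonneg fun v _ => h0 u v

lemma eW_mono (h0 : ∀ u v, 0 ≤ a u v) {S S' T T' : Finset V} (h : S ⊆ S') (h' : T ⊆ T') :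
    eW a S T ≤ eW a S' T' := by
  unfold eW
  refine (Finset.sum_le_sum fun u _ => Finset.sum_le_sum_of_subset_of_nonneg h'
    fun v _ _ => h0 u v).trans ?_
  exact Finset.sum_le_sum_of_subset_of_nonneg h fun u _ _ => Finset.sum_nonneg fun v _ => h0 u v

lemma eW_le_of_deg {S T : Finset V} {c : ℝ} (h : ∀ u ∈ S, eW a {u} T ≤ c) :
    eW a S T ≤ S.card * c := by
  unfold eW at *
  refine (Finset.sum_le_card_nsmul S _ c fun u hu => ?_).trans (by simp)
  simpa using h u hu

lemma eW_ge_of_deg {S T : Finset V} {c : ℝ} (h : ∀ u ∈ S, c ≤ eW a {u} T) :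
    S.card * c ≤ eW a S T := by
  unfold eW at *
  refine le_trans (by simp) (Finset.card_nsmul_le_sum S _ c fun u hu => ?_)
  simpa using h u hu

lemma eW_le (h1 : ∀ u v, a u v ≤ 1) (S T : Finset V) : eW a S T ≤ S.card * T.card := by
  apply eW_le_of_deg
  intro u _
  unfold eW
  simp only [Finset.sum_singleton]
  refine (Finset.sum_le_card_nsmul T _ 1 fun v _ => h1 u v).trans (by simp)

lemma three_sq (x y z α : ℝ) (hx : 0 ≤ x) (hy : 0 ≤ y) (hz : 0 ≤ z) (h : x + y + z = 1)
    (hα : 0 < α) (hα' : α ≤ 4/9) (hxc : x < 2/3 + α/2) (hyc : y < 2/3 + α/2)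
    (hzc : z < 2/3+α/2) : x^2+y^2+z^2 ≤ 5/9 + α/3 + α^2/2 := by
  have key : ∀ p q r : ℝ, 0 ≤ p → 0 ≤ q → 0 ≤ r → p + q + r = 1 → p < 2/3+α/2 → q ≤ p → r ≤ p →
      p^2+q^2+r^2 ≤ 5/9 + α/3 + α^2/2 := by
    intro p q r hp hq hr h1 hpc hqp hrp
    rcases le_total p (1/2) with h2 | h2
    · have e1 : q^2 ≤ p * q := by nlinarith
      have e2 : r^2 ≤ p * r := by nlinarith
      have e3 : p^2 + p*q + p*r = p := by
        have : p * (p + q + r) = p * 1 := by rw [h1]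
        linarith
      nlinarith [sq_nonneg α]
    · have hqr : q^2 + r^2 ≤ (1-p)^2 := by
        have : 1 - p = q + r := by linarith
        rw [this]; nlinarith [mul_nonneg hq hr]
      have := mul_nonneg (sub_nonneg.2 hpc.le) (by linarith : 0 ≤ p + (2/3+α/2) - 1)
      have e : (2/3+α/2)^2 + (1-(2/3+α/2))^2 - (p^2 + (1-p)^2) = 2 * ((2/3+α/2-p) * (p + (2/3+α/2) - 1)) := by ring
      have e' : (2/3+α/2)^2 + (1-(2/3+α/2))^2 = 5/9 + α/3 + α^2/2 := by ring
      linarith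
  rcases le_total x y with h1 | h1 <;> rcases le_total y z with h2 | h2 <;>
    rcases le_total x z with h3 | h3
  all_goals first
    | (have := key x y z hx hy hz h hxc (by linarith) (by linarith); linarith)
    | (have := key y x z hy hx hz (by linarith) hyc (by linarith) (by linarith); linarith)
    | (have := key z x y hz hx hy (by linarith) hzc (by linarith) (by linarith); linarith)

end eWsec

section extract
variable {V : Type*} [Fintype V] [DecidableEq V] {a : V → V → ℝ}

lemma extraction (hs : ∀ u v, a u v = a v u) (h0 : ∀ u v, 0 ≤ a u v) (h1 : ∀ u v, a u v ≤ 1)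
    {α ψ : ℝ} (hα : 0 < α) (hψ : 0 < ψ) (hψα : ψ ≤ α / 9) (hn : 0 < Fintype.card V)
    (he : (5/9 + α) * (Fintype.card V : ℝ)^2 ≤ eW a univ univ) :
    ∃ W : Finset V, (2/3 + α/2) * (Fintype.card V : ℝ) ≤ W.card ∧
      eW a W Wᶜ ≤ ψ * Fintype.card V * (Wᶜ).card ∧
      ∀ S T : Finset V, S ∪ T = W → Disjoint S T → S.Nonempty → T.Nonempty →
        ∀ c : ℝ, c ≤ S.card → c ≤ T.card → ψ * Fintype.card V * c < eW a S T := by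
  set n : ℝ := (Fintype.card V : ℝ) with hnd
  have hnp : 0 < n := by rw [hnd]; exact_mod_cast hn
  have hα' : α ≤ 4/9 := by
    have := eW_le h1 univ (univ : Finset V)
    rw [Finset.card_univ, ← hnd] at this
    have h2 : (5/9 + α) * n^2 ≤ 1 * n^2 := by nlinarith
    have := le_of_mul_le_mul_right h2 (by positivity)
    linarith
  let P : Finset V → Prop := fun W => (2/3 + α/2) * n ≤ W.card ∧ eW a W Wᶜ ≤ ψ * n * (Wᶜ).card
  have hP : P univ := by
    refine ⟨?_, ?_⟩
    · rw [Finset.card_univ, ← hnd]; nlinarith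
    · simp [eW]
  obtain ⟨W, hW, hmin⟩ := exists_minimal_of_wellFoundedLT P ⟨_, hP⟩
  refine ⟨W, hW.1, hW.2, ?_⟩
  -- if S is large then contradiction
  have small : ∀ S T : Finset V, S ∪ T = W → Disjoint S T → T.Nonempty →
      eW a S T ≤ ψ * n * T.card → (S.card : ℝ) < (2/3 + α/2) * n := by
    intro S T hST hd hT hle
    by_contra hc
    push Not at hc
    have hSc : Sᶜ = T ∪ Wᶜ := by
      ext v; have := Finset.disjoint_left.1 hd
      specialize @this v
      simp [← hST]; tauto
    have hd2 : Disjoint T Wᶜ := by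
      rw [Finset.disjoint_left]; intro v hv; simp [← hST, hv]
    have hPS : P S := by
      refine ⟨hc, ?_⟩
      rw [hSc, eW_union_right hd2, Finset.card_union_of_disjoint hd2]
      have : eW a S Wᶜ ≤ eW a W Wᶜ := eW_mono h0 (hST ▸ Finset.subset_union_left) subset_rfl
      have := hW.2
      push_cast
      linarith
    have hle' : S ≤ W := hST ▸ Finset.subset_union_left
    have := hmin hPS hle'
    obtain ⟨t, ht⟩ := hT
    have h3 : t ∈ S := this (by rw [← hST]; simp [ht])
    exact Finset.disjoint_left.1 hd h3 ht
  intro S T hST hd hS hT c hcS hcT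
  by_contra hc
  push Not at hc
  have e1 : eW a S T ≤ ψ * n * T.card :=
    hc.trans (by gcongr)
  have e2 : eW a T S ≤ ψ * n * S.card := by
    rw [eW_comm hs]; exact hc.trans (by gcongr)
  have s1 := small S T hST hd hT e1
  have s2 := small T S (by rw [Finset.union_comm]; exact hST) hd.symm hS e2
  have hcard : (S.card : ℝ) + T.card + (Wᶜ).card = n := by
    have : W.card + (Wᶜ).card = Fintype.card V := Finset.card_add_card_compl W
    rw [← hST, Finset.card_union_of_disjoint hd, hST] at this
    rw [hnd]; exact_mod_cast this
  have hWc : (W.card : ℝ) = S.card + T.card := by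
    rw [← hST, Finset.card_union_of_disjoint hd]; push_cast; rfl
  have hW1 := hW.1
  have hW2 := hW.2
  have s3 : ((Wᶜ).card : ℝ) < (2/3 + α/2) * n := by
    have := mul_pos hα hnp
    linarith
  have tot : eW a univ univ = eW a S S + eW a T T + eW a Wᶜ Wᶜ + 2 * eW a S T + 2 * eW a W Wᶜ := by
    have hdW : Disjoint W Wᶜ := disjoint_compl_right
    have : (univ : Finset V) = W ∪ Wᶜ := by simp
    rw [this, eW_union_left hdW, eW_union_right hdW, eW_union_right hdW, eW_comm hs Wᶜ W]
    have : eW a W W = eW a S S + eW a T T + 2 * eW a S T := by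
      rw [← hST, eW_union_left hd, eW_union_right hd, eW_union_right hd, eW_comm hs T S]; ring
    rw [this]; ring
  have b1 := eW_le h1 S S
  have b2 := eW_le h1 T T
  have b3 := eW_le h1 Wᶜ Wᶜ
  have t := three_sq (S.card / n) (T.card / n) ((Wᶜ).card / n) α (by positivity) (by positivity)
    (by positivity) (by field_simp; exact hcard) hα hα' (by rwa [div_lt_iff₀ hnp])
    (by rwa [div_lt_iff₀ hnp]) (by rwa [div_lt_iff₀ hnp])
  have t' : (S.card : ℝ)^2 + (T.card:ℝ)^2 + ((Wᶜ).card : ℝ)^2 ≤ (5/9 + α/3 + α^2/2) * n^2 := by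
    have : ((S.card : ℝ)^2 + (T.card:ℝ)^2 + ((Wᶜ).card : ℝ)^2) / n^2 ≤ (5/9 + α/3 + α^2/2) := by
      refine le_trans (le_of_eq ?_) t
      field_simp
    rwa [div_le_iff₀ (by positivity)] at this
  have cr : eW a S T + eW a W Wᶜ ≤ ψ * n * n := by
    have : ψ * n * (T.card + (Wᶜ).card) ≤ ψ * n * n := by
      gcongr
      have : (0:ℝ) ≤ S.card := by positivity
      linarith
    linarith
  have fin : (5/9 + α) * n^2 ≤ (5/9 + α/3 + α^2/2 + 2 * ψ) * n^2 := by linarith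
  have := le_of_mul_le_mul_right fin (by positivity)
  nlinarith

lemma nonbip (hs : ∀ u v, a u v = a v u) (h1 : ∀ u v, a u v ≤ 1)
    {α ψ : ℝ} (hα : 0 < α) (hψ : 0 < ψ)
    (he : (5/9 + α) * (Fintype.card V : ℝ)^2 ≤ eW a univ univ)
    (W : Finset V) (hW1 : (2/3 + α/2) * (Fintype.card V : ℝ) ≤ W.card)
    (hW2 : eW a W Wᶜ ≤ ψ * Fintype.card V * (Wᶜ).card) (S T : Finset V) (hST : S ∪ T = W)
    (hd : Disjoint S T) :
    (1/18 - 2 * ψ) * (Fintype.card V : ℝ)^2 ≤ eW a S S + eW a T T := by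
  set n : ℝ := (Fintype.card V : ℝ) with hnd
  have hn0 : 0 ≤ n := by positivity
  have tot : eW a univ univ = eW a S S + eW a T T + eW a Wᶜ Wᶜ + 2 * eW a S T + 2 * eW a W Wᶜ := by
    have hdW : Disjoint W Wᶜ := disjoint_compl_right
    have : (univ : Finset V) = W ∪ Wᶜ := by simp
    rw [this, eW_union_left hdW, eW_union_right hdW, eW_union_right hdW, eW_comm hs Wᶜ W]
    have : eW a W W = eW a S S + eW a T T + 2 * eW a S T := by
      rw [← hST, eW_union_left hd, eW_union_right hd, eW_union_right hd, eW_comm hs T S]; ring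
    rw [this]; ring
  have hcard : (W.card : ℝ) + (Wᶜ).card = n := by
    have : W.card + (Wᶜ).card = Fintype.card V := Finset.card_add_card_compl W
    rw [hnd]; exact_mod_cast this
  have hWc : (W.card : ℝ) = S.card + T.card := by
    rw [← hST, Finset.card_union_of_disjoint hd]; push_cast; rfl
  have b3 := eW_le h1 Wᶜ Wᶜ
  have b4 := eW_le h1 S T
  have hr : ((Wᶜ).card : ℝ) = n - W.card := by linarith
  have hr0 : (0:ℝ) ≤ (Wᶜ).card := by positivity
  have hW0 : (0:ℝ) ≤ W.card := by positivity
  have c1 : ψ * n * (Wᶜ).card ≤ ψ * n * n := by gcongr; linarith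
  have c2 : 2 * ((S.card : ℝ) * T.card) ≤ (W.card : ℝ)^2 / 2 := by
    rw [hWc]; nlinarith [sq_nonneg ((S.card : ℝ) - T.card)]
  have c3 : (W.card : ℝ)^2 / 2 + ((Wᶜ).card : ℝ) * (Wᶜ).card ≤ n^2 / 2 := by
    rw [hr] at hr0 ⊢
    have : 0 ≤ (n - W.card) * (3 * W.card - n) := mul_nonneg hr0 (by nlinarith)
    nlinarith
  nlinarith

end extract
/-- number of walks of a given length from `y`, inside `W` -/
noncomputable def fw {V : Type*} [DecidableEq V] (a : V → V → ℝ) (W : Finset V) (y : V) :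
    ℕ → V → ℝ
  | 0, v => if v = y then 1 else 0
  | (i + 1), v => ∑ u ∈ W, a v u * fw a W y i u

/-- thresholds -/
noncomputable def bseq (η : ℝ) : ℕ → ℝ
  | 0 => η
  | (m + 1) => η * (bseq η m) ^ 3

lemma bseq_pos {η : ℝ} (h : 0 < η) : ∀ m, 0 < bseq η m
  | 0 => h
  | (m + 1) => by have := bseq_pos h m; unfold bseq; positivity

lemma bseq_le_one {η : ℝ} (h : 0 < η) (h1 : η ≤ 1) : ∀ m, bseq η m ≤ 1
  | 0 => h1
  | (m + 1) => by
    have h2 := bseq_le_one h h1 m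
    have h3 := bseq_pos h m
    unfold bseq
    exact mul_le_one₀ h1 (by positivity) (pow_le_one₀ h3.le h2)

lemma bseq_succ_le {η : ℝ} (h : 0 < η) (h1 : η ≤ 1) (m : ℕ) :
    bseq η (m+1) ≤ η * bseq η m := by
  have h2 := bseq_le_one h h1 m
  have h3 := bseq_pos h m
  show η * (bseq η m)^3 ≤ _
  gcongr
  exact pow_le_of_le_one h3.le h2 (by norm_num)

section walks
variable {V : Type*} [DecidableEq V] {a : V → V → ℝ}

lemma eW_subadd_left (h0 : ∀ u v, 0 ≤ a u v) (S S' T : Finset V) :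
    eW a (S ∪ S') T ≤ eW a S T + eW a S' T := by
  rw [← Finset.union_sdiff_self_eq_union, eW_union_left Finset.disjoint_sdiff]
  have : eW a (S' \ S) T ≤ eW a S' T := eW_mono h0 Finset.sdiff_subset subset_rfl
  linarith

lemma eW_subadd_right (h0 : ∀ u v, 0 ≤ a u v) (S S' T : Finset V) :
    eW a T (S ∪ S') ≤ eW a T S + eW a T S' := by
  rw [← Finset.union_sdiff_self_eq_union, eW_union_right Finset.disjoint_sdiff]
  have : eW a T (S' \ S) ≤ eW a T S' := eW_mono h0 subset_rfl Finset.sdiff_subset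
  linarith

lemma fw_nonneg (h0 : ∀ u v, 0 ≤ a u v) (W : Finset V) (y : V) :
    ∀ i v, 0 ≤ fw a W y i v
  | 0, v => by unfold fw; split_ifs <;> norm_num
  | (i + 1), v => by
    unfold fw
    exact Finset.sum_nonneg fun u _ => mul_nonneg (h0 v u) (fw_nonneg h0 W y i u)

lemma fw_le (h0 : ∀ u v, 0 ≤ a u v) (h1 : ∀ u v, a u v ≤ 1) (W : Finset V) (y : V) {n : ℝ}
    (hn : (W.card : ℝ) ≤ n) : ∀ i v, fw a W y (i+1) v ≤ n ^ i
  | 0, v => by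
    simp only [fw, pow_zero, mul_ite, mul_one, mul_zero, Finset.sum_ite_eq']
    split_ifs
    · exact h1 _ _
    · norm_num
  | (i + 1), v => by
    have hn0 : 0 ≤ n := le_trans (by positivity) hn
    rw [fw]
    calc ∑ u ∈ W, a v u * fw a W y (i+1) u ≤ ∑ u ∈ W, n ^ i := by
          refine Finset.sum_le_sum fun u _ => ?_
          have := fw_le h0 h1 W y hn i u
          have h3 := fw_nonneg h0 W y (i+1) u
          calc a v u * fw a W y (i+1) u ≤ 1 * fw a W y (i+1) u := by gcongr; exact h1 v u
            _ ≤ _ := by linarith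
      _ = W.card * n ^ i := by simp
      _ ≤ n * n ^ i := by gcongr
      _ = _ := by ring

/-- the reachable sets -/
noncomputable def XS (a : V → V → ℝ) (W : Finset V) (y : V) (η n : ℝ) (m : ℕ) : Finset V :=
  W.filter fun v => bseq η m * n ^ (m + 1) ≤ fw a W y (m + 2) v

lemma mem_XS {W : Finset V} {y : V} {η n : ℝ} {m : ℕ} {v : V} :
    v ∈ XS a W y η n m ↔ v ∈ W ∧ bseq η m * n ^ (m + 1) ≤ fw a W y (m + 2) v := by
  simp [XS]

lemma XS_sub {W : Finset V} {y : V} {η n : ℝ} {m : ℕ} : XS a W y η n m ⊆ W :=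
  Finset.filter_subset _ _

lemma XS_grow (h0 : ∀ u v, 0 ≤ a u v) {W : Finset V} {y : V} {η n : ℝ} (hη : 0 < η)
    (hη1 : η ≤ 1) (hn : 0 < n) {m : ℕ} {v : V} (hv : v ∈ W)
    (h : η * n ≤ eW a {v} (XS a W y η n m)) : v ∈ XS a W y η n (m + 1) := by
  rw [mem_XS]
  refine ⟨hv, ?_⟩
  have hb := bseq_pos hη m
  have hfw : fw a W y (m+1+2) v = ∑ u ∈ W, a v u * fw a W y (m+2) u := rfl
  rw [hfw]
  calc bseq η (m+1) * n ^ (m+1+1) ≤ (η * bseq η m) * n ^ (m+1+1) := by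
        gcongr; exact bseq_succ_le hη hη1 m
    _ = (η * n) * (bseq η m * n ^ (m+1)) := by ring
    _ ≤ eW a {v} (XS a W y η n m) * (bseq η m * n ^ (m+1)) := by gcongr
    _ = ∑ u ∈ XS a W y η n m, a v u * (bseq η m * n ^ (m+1)) := by
        simp [eW, Finset.sum_mul]
    _ ≤ ∑ u ∈ XS a W y η n m, a v u * fw a W y (m+2) u := by
        refine Finset.sum_le_sum fun u hu => ?_
        have := (mem_XS.1 hu).2
        exact mul_le_mul_of_nonneg_left this (h0 v u)
    _ ≤ _ := Finset.sum_le_sum_of_subset_of_nonneg XS_sub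
        fun u _ _ => mul_nonneg (h0 v u) (fw_nonneg h0 W y _ u)

lemma XS_mono2 (h01 : ∀ u v, a u v = 0 ∨ a u v = 1) (hs : ∀ u v, a u v = a v u)
    {W : Finset V} {y : V} {ψ η n : ℝ} (hψ : 0 < ψ) (hη : 0 < η)
    (hη1 : η ≤ 1) (hηψ : η ^ 2 ≤ ψ ^ 2 / 8) (hn : 0 < n) (hW : (W.card : ℝ) ≤ n)
    (hdeg : ∀ v ∈ W, ψ * n ≤ eW a {v} W) (m : ℕ) :
    XS a W y η n m ⊆ XS a W y η n (m + 2) := by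
  have h0 : ∀ u v, 0 ≤ a u v := fun u v => by rcases h01 u v with h | h <;> rw [h]; norm_num
  have h1 : ∀ u v, a u v ≤ 1 := fun u v => by rcases h01 u v with h | h <;> rw [h]; norm_num
  intro v hv
  rw [mem_XS] at hv ⊢
  obtain ⟨hvW, hv⟩ := hv
  refine ⟨hvW, ?_⟩
  set b := bseq η m with hb
  have hbp : 0 < b := bseq_pos hη m
  have hb1 : b ≤ 1 := bseq_le_one hη hη1 m
  have hbb : bseq η (m+2) ≤ (b/2)^3 * ψ^2 := by
    have e1 := bseq_succ_le hη hη1 (m+1)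
    have e2 : bseq η (m+1) = η * b^3 := rfl
    rw [e2] at e1
    calc bseq η (m+2) ≤ η * (η * b^3) := e1
      _ = η^2 * b^3 := by ring
      _ ≤ (ψ^2/8) * b^3 := by gcongr
      _ = _ := by ring
  set U := W.filter fun u => a v u = 1 ∧ b / 2 * n ^ m ≤ fw a W y (m+1) u with hU
  have hUW : U ⊆ W := Finset.filter_subset _ _
  have hUcard : b / 2 * n ≤ U.card := by
    have hle : fw a W y (m+2) v ≤ U.card * n^m + n * (b / 2 * n^m) := by
      have : fw a W y (m+2) v = ∑ u ∈ W, a v u * fw a W y (m+1) u := rfl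
      rw [this, ← Finset.sum_filter_add_sum_filter_not W
        (fun u => a v u = 1 ∧ b / 2 * n ^ m ≤ fw a W y (m+1) u)]
      apply add_le_add
      · refine (Finset.sum_le_card_nsmul _ _ (n^m) fun u _ => ?_).trans (by simp [hU])
        have := fw_le h0 h1 W y hW m u
        have h3 := fw_nonneg h0 W y (m+1) u
        calc a v u * fw a W y (m+1) u ≤ 1 * fw a W y (m+1) u := by gcongr; exact h1 v u
            _ ≤ _ := by linarith
      · refine (Finset.sum_le_card_nsmul _ _ (b / 2 * n^m) fun u hu => ?_).trans ?_
        · rw [Finset.mem_filter] at hu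
          rcases h01 v u with h | h
          · rw [h]; simp; positivity
          · rw [h, one_mul]
            by_contra hc
            exact hu.2 ⟨h, (not_le.1 hc).le⟩
        · rw [nsmul_eq_mul]
          gcongr
          refine le_trans ?_ hW
          exact_mod_cast Finset.card_filter_le _ _
    have h3 : (b / 2 * n) * n^m ≤ U.card * n^m := by
      have : b * n^(m+1) = (b/2*n)*n^m + n * (b/2*n^m) := by ring
      linarith
    exact le_of_mul_le_mul_right h3 (by positivity)
  -- degrees into U
  set d : V → ℝ := fun x => ∑ u ∈ U, a u x with hd
  have hsum : (b/2 * n) * (ψ * n) ≤ ∑ x ∈ W, d x := by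
    calc (b/2 * n) * (ψ * n) ≤ U.card * (ψ * n) := by gcongr
      _ ≤ eW a U W := eW_ge_of_deg fun u hu => hdeg u (hUW hu)
      _ = _ := by unfold eW; rw [Finset.sum_comm]
  have hcs : (b/2)^2 * ψ^2 * n^3 ≤ ∑ x ∈ W, d x ^ 2 := by
    have h2 := sq_sum_le_card_mul_sum_sq (s := W) (f := d)
    have h3 : ((b/2 * n) * (ψ * n))^2 ≤ (∑ x ∈ W, d x)^2 := by gcongr
    have h4 : (0:ℝ) ≤ ∑ x ∈ W, d x ^ 2 := Finset.sum_nonneg fun x _ => sq_nonneg _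
    have h5 : (W.card : ℝ) * ∑ x ∈ W, d x ^ 2 ≤ n * ∑ x ∈ W, d x ^ 2 := by gcongr
    have h6 : n * ((b/2)^2 * ψ^2 * n^3) ≤ n * ∑ x ∈ W, d x ^ 2 := by
      calc n * ((b/2)^2 * ψ^2 * n^3) = ((b/2 * n) * (ψ * n))^2 := by ring
        _ ≤ _ := by linarith
    exact le_of_mul_le_mul_left h6 hn
  have step2 : ∀ x, d x * (b/2 * n^m) ≤ fw a W y (m+2) x := by
    intro x
    have : fw a W y (m+2) x = ∑ u ∈ W, a x u * fw a W y (m+1) u := rfl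
    rw [this, hd, Finset.sum_mul]
    refine le_trans (Finset.sum_le_sum fun u hu => ?_)
      (Finset.sum_le_sum_of_subset_of_nonneg hUW
        fun u _ _ => mul_nonneg (h0 x u) (fw_nonneg h0 W y _ u))
    rw [hs u x]
    exact mul_le_mul_of_nonneg_left (Finset.mem_filter.1 hu).2.2 (h0 x u)
  have step4 : ∑ x ∈ W, d x * fw a W y (m+2) x ≤ fw a W y (m+2+2) v := by
    have e1 : fw a W y (m+2+2) v = ∑ u ∈ W, a v u * fw a W y (m+3) u := rfl
    have e2 : ∀ u, fw a W y (m+3) u = ∑ x ∈ W, a u x * fw a W y (m+2) x := fun u => rfl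
    rw [e1]
    calc ∑ x ∈ W, d x * fw a W y (m+2) x = ∑ u ∈ U, fw a W y (m+3) u := by
          simp_rw [e2, hd, Finset.sum_mul]
          rw [Finset.sum_comm]
      _ = ∑ u ∈ U, a v u * fw a W y (m+3) u := by
          refine Finset.sum_congr rfl fun u hu => ?_
          rw [(Finset.mem_filter.1 hu).2.1, one_mul]
      _ ≤ _ := Finset.sum_le_sum_of_subset_of_nonneg hUW
        fun u _ _ => mul_nonneg (h0 v u) (fw_nonneg h0 W y _ u)
  refine le_trans ?_ step4
  calc bseq η (m+2) * n ^ (m+2+1) ≤ ((b/2)^3 * ψ^2) * n^(m+2+1) := by gcongr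
    _ = (b/2 * n^m) * ((b/2)^2 * ψ^2 * n^3) := by ring
    _ ≤ (b/2 * n^m) * ∑ x ∈ W, d x ^ 2 := by gcongr
    _ = ∑ x ∈ W, d x * (d x * (b/2 * n^m)) := by
        rw [Finset.mul_sum]; exact Finset.sum_congr rfl fun x _ => by ring
    _ ≤ _ := by
        refine Finset.sum_le_sum fun x _ => ?_
        refine mul_le_mul_of_nonneg_left (step2 x) ?_
        exact Finset.sum_nonneg fun u _ => h0 u x

lemma XS_start (h0 : ∀ u v, 0 ≤ a u v) (h1 : ∀ u v, a u v ≤ 1) (hs : ∀ u v, a u v = a v u)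
    {W : Finset V} {y : V} (hy : y ∈ W) {ψ η n : ℝ} (hψ : 0 < ψ) (hη : 0 < η)
    (hηψ : η ≤ ψ ^ 2 / 2) (hn : 0 < n) (hW : (W.card : ℝ) ≤ n)
    (hdeg : ∀ v ∈ W, ψ * n ≤ eW a {v} W) :
    ψ ^ 2 / 2 * n ≤ (XS a W y η n 0).card := by
  have f1 : ∀ u, fw a W y 1 u = a u y := by
    intro u; simp [fw, hy]
  have low : ψ * n * (ψ * n) ≤ ∑ v ∈ W, fw a W y 2 v := by
    have : ∀ v, fw a W y 2 v = ∑ u ∈ W, a v u * a u y := by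
      intro v
      have : fw a W y 2 v = ∑ u ∈ W, a v u * fw a W y 1 u := rfl
      rw [this]; simp_rw [f1]
    simp_rw [this]
    rw [Finset.sum_comm]
    calc ψ * n * (ψ * n) ≤ eW a {y} W * (ψ * n) := by gcongr; exact hdeg y hy
      _ = ∑ u ∈ W, a y u * (ψ * n) := by simp [eW, Finset.sum_mul]
      _ ≤ ∑ u ∈ W, a y u * eW a {u} W :=
          Finset.sum_le_sum fun u hu => mul_le_mul_of_nonneg_left (hdeg u hu) (h0 _ _)
      _ = _ := by
          refine Finset.sum_congr rfl fun u _ => ?_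
          simp only [eW, Finset.sum_singleton, Finset.mul_sum]
          refine Finset.sum_congr rfl fun v _ => ?_
          rw [hs y u, hs u v]; ring
  have up : ∑ v ∈ W, fw a W y 2 v ≤ (XS a W y η n 0).card * n + n * (η * n) := by
    rw [← Finset.sum_filter_add_sum_filter_not W
        (fun v => bseq η 0 * n ^ (0 + 1) ≤ fw a W y (0 + 2) v)]
    apply add_le_add
    · refine (Finset.sum_le_card_nsmul _ _ n fun u _ => ?_).trans (by simp [XS])
      have := fw_le h0 h1 W y hW 1 u
      simpa using this
    · refine (Finset.sum_le_card_nsmul _ _ (η * n) fun u hu => ?_).trans ?_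
      · have := (Finset.mem_filter.1 hu).2
        simp only [bseq] at this
        simp at this
        exact this.le
      · rw [nsmul_eq_mul]
        gcongr
        refine le_trans ?_ hW
        exact_mod_cast Finset.card_filter_le _ _
  have h3 : (ψ^2 - η) * n * n ≤ (XS a W y η n 0).card * n := by linarith
  have h4 := le_of_mul_le_mul_right h3 hn
  have : ψ^2/2 * n ≤ (ψ^2 - η) * n := by gcongr; linarith
  linarith

end walks
section conn
variable {V : Type*} [DecidableEq V] {a : V → V → ℝ}

lemma walks_many (h01 : ∀ u v, a u v = 0 ∨ a u v = 1) (hs : ∀ u v, a u v = a v u)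
    {W : Finset V} {ψ η n : ℝ} (hψ : 0 < ψ) (hψ1 : ψ ≤ 1/200) (hη : η = ψ^3/10)
    (hn : 0 < n) (hW : (W.card : ℝ) ≤ n)
    (hdeg : ∀ v ∈ W, ψ * n ≤ eW a {v} W)
    (hcut : ∀ S T : Finset V, S ∪ T = W → Disjoint S T → S.Nonempty → T.Nonempty →
        ∀ c : ℝ, c ≤ S.card → c ≤ T.card → ψ * n * c < eW a S T)
    (hnb : ∀ S T : Finset V, S ∪ T = W → Disjoint S T →
        (1/18 - 2 * ψ) * n^2 ≤ eW a S S + eW a T T)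
    (t : ℕ) (ht : 2 / η < t) {y z : V} (hy : y ∈ W) (hz : z ∈ W) :
    bseq η (2*t+1) * n ^ (2*t+2) ≤ fw a W y (2*t+3) z := by
  have h0 : ∀ u v, 0 ≤ a u v := fun u v => by rcases h01 u v with h | h <;> rw [h]; norm_num
  have h1 : ∀ u v, a u v ≤ 1 := fun u v => by rcases h01 u v with h | h <;> rw [h]; norm_num
  have hηp : 0 < η := by rw [hη]; positivity
  have p2 : ψ^2 ≤ ψ * (1/200) := by rw [pow_two]; gcongr
  have p3 : ψ^3 ≤ ψ^2 * (1/200) := by rw [pow_succ]; gcongr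
  have hη1 : η ≤ 1 := by linarith
  have hηψ2 : η ^ 2 ≤ ψ ^ 2 / 8 := by
    have : η ≤ ψ / 10 := by linarith
    have : η^2 ≤ (ψ/10)^2 := by gcongr
    have : 0 < ψ^2 := by positivity
    linarith
  set X := XS a W y η n with hX
  have hmono : ∀ m, X m ⊆ X (m+2) := XS_mono2 h01 hs hψ hηp hη1 hηψ2 hn hW hdeg
  have hmono0 : ∀ s, X 0 ⊆ X (2*s) := by
    intro s
    induction s with
    | zero => exact subset_rfl
    | succ s ih => exact ih.trans (hmono (2*s))
  have hsub : ∀ m, X m ⊆ W := fun m => XS_sub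
  have hcW : ∀ m, ((X m).card : ℝ) ≤ n := fun m =>
    le_trans (by exact_mod_cast Finset.card_le_card (hsub m)) hW
  have hgrow : ∀ m, ∀ v ∈ W, η * n ≤ eW a {v} (X m) → v ∈ X (m+1) :=
    fun m v hv h => XS_grow h0 hηp hη1 hn hv h
  have hstart : ψ ^ 2 / 2 * n ≤ (X 0).card :=
    XS_start h0 h1 hs hy hψ hηp (by linarith [pow_pos hψ 2]) hn hW hdeg
  -- pigeonhole
  obtain ⟨s, hst, hs1, hs2⟩ : ∃ s < t, ((X (2*s+2) \ X (2*s)).card : ℝ) ≤ η * n ∧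
      ((X (2*s+1+2) \ X (2*s+1)).card : ℝ) ≤ η * n := by
    by_contra hc
    push Not at hc
    have hstep : ∀ m, ((X (m+2)).card : ℝ) = (X m).card + ((X (m+2) \ X m).card : ℝ) := by
      intro m
      have := Finset.card_sdiff_add_card_eq_card (hmono m)
      rw [← this]; push_cast; ring
    have key : ∀ s ≤ t, s * (η * n) ≤ ((X (2*s)).card : ℝ) + (X (2*s+1)).card := by
      intro s
      induction s with
      | zero => intro _; simp; positivity
      | succ s ih =>
        intro hs'
        have ih' := ih (by omega)
        have e1 := hstep (2*s)
        have e2 := hstep (2*s+1)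
        have q1 : (0:ℝ) ≤ ((X (2*s+2) \ X (2*s)).card : ℝ) := by positivity
        have q2 : (0:ℝ) ≤ ((X (2*s+1+2) \ X (2*s+1)).card : ℝ) := by positivity
        show ((s+1 : ℕ) : ℝ) * (η * n) ≤ ((X (2*s+2)).card : ℝ) + (X (2*s+1+2)).card
        push_cast
        rw [e1, e2]
        rcases le_or_gt ((X (2*s+2) \ X (2*s)).card : ℝ) (η * n) with h | h
        · have := hc s (by omega) h
          linarith
        · linarith
    have k := key t le_rfl
    have c1 := hcW (2*t)
    have c2 := hcW (2*t+1)
    rw [div_lt_iff₀ hηp] at ht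
    have : 2 * n < t * η * n := by gcongr
    linarith
  set A := X (2*s) with hA
  set B := X (2*s+1) with hB
  have hAW : A ⊆ W := hsub _
  have hBW : B ⊆ W := hsub _
  have eAB : eW a A (W \ B) ≤ η * n^2 := by
    rw [eW_comm hs]
    have h : eW a (W \ B) A ≤ (W \ B).card * (η * n) := by
      apply eW_le_of_deg
      intro u hu
      rw [Finset.mem_sdiff] at hu
      by_contra hc
      exact hu.2 (hgrow _ u hu.1 (not_le.1 hc).le)
    have h2 : ((W \ B).card : ℝ) ≤ n := le_trans
      (by exact_mod_cast Finset.card_le_card Finset.sdiff_subset) hW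
    calc _ ≤ _ := h
      _ ≤ n * (η * n) := by gcongr
      _ = _ := by ring
  have eBA : eW a B (W \ A) ≤ 2 * η * n^2 := by
    have hsplit : W \ A ⊆ (W \ X (2*s+2)) ∪ (X (2*s+2) \ A) := by
      intro v; simp only [Finset.mem_sdiff, Finset.mem_union]; tauto
    have h : eW a (W \ X (2*s+2)) B ≤ (W \ X (2*s+2)).card * (η * n) := by
      apply eW_le_of_deg
      intro u hu
      rw [Finset.mem_sdiff] at hu
      by_contra hc
      exact hu.2 (hgrow (2*s+1) u hu.1 (not_le.1 hc).le)
    have h2 : ((W \ X (2*s+2)).card : ℝ) ≤ n := le_trans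
      (by exact_mod_cast Finset.card_le_card Finset.sdiff_subset) hW
    have h3 := eW_le h1 B (X (2*s+2) \ A)
    have h4 : (B.card : ℝ) * ((X (2*s+2) \ A).card : ℝ) ≤ n * (η * n) := by
      gcongr
      exact hcW _
    have h5 : ((W \ X (2*s+2)).card : ℝ) * (η * n) ≤ n * (η * n) := by gcongr
    have h6 := eW_mono h0 (subset_refl B) hsplit
    have h7 := eW_subadd_right h0 (W \ X (2*s+2)) (X (2*s+2) \ A) B
    rw [eW_comm hs B (W \ X (2*s+2))] at h7
    linarith
  have hn2 : 0 < n^2 := by positivity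
  have hψn : 0 < ψ * n := by positivity
  -- main claim
  have main : ((W \ (A ∩ B)).card : ℝ) ≤ ψ * n / 2 := by
    by_contra hbig
    push Not at hbig
    have c1 : ((A ∩ B).card : ℝ) ≤ ψ * n / 2 := by
      by_contra hc
      push Not at hc
      have hlt := hcut (A ∩ B) (W \ (A ∩ B))
        (Finset.union_sdiff_of_subset (Finset.inter_subset_left.trans hAW))
        Finset.disjoint_sdiff
        (by rw [← Finset.card_pos]; have : (0:ℝ) < ((A ∩ B).card : ℝ) := by linarith
            exact_mod_cast this)
        (by rw [← Finset.card_pos]; have : (0:ℝ) < ((W \ (A ∩ B)).card : ℝ) := by linarith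
            exact_mod_cast this) (ψ * n / 2) hc.le hbig.le
      have hsp : W \ (A ∩ B) ⊆ (W \ B) ∪ (W \ A) := by
        intro v; simp only [Finset.mem_sdiff, Finset.mem_union, Finset.mem_inter]; tauto
      have l1 := eW_mono h0 (subset_refl (A ∩ B)) hsp
      have l2 := eW_subadd_right h0 (W \ B) (W \ A) (A ∩ B)
      have l3 : eW a (A ∩ B) (W \ B) ≤ eW a A (W \ B) :=
        eW_mono h0 Finset.inter_subset_left subset_rfl
      have l4 : eW a (A ∩ B) (W \ A) ≤ eW a B (W \ A) :=
        eW_mono h0 Finset.inter_subset_right subset_rfl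
      have : (ψ^2/2) * n^2 < (3 * η) * n^2 := by linarith
      have := lt_of_mul_lt_mul_right this hn2.le
      have : 0 < ψ^2 := by positivity
      linarith
    have c2 : ((W \ (A ∪ B)).card : ℝ) ≤ ψ * n / 2 := by
      by_contra hc
      push Not at hc
      have hAc : ψ ^ 2 / 2 * n ≤ A.card :=
        hstart.trans (by exact_mod_cast Finset.card_le_card (hmono0 s))
      have hABc : ψ ^ 2 / 2 * n ≤ (A ∪ B).card :=
        hAc.trans (by exact_mod_cast Finset.card_le_card Finset.subset_union_left)
      have hsm : ψ ^ 2 / 2 * n ≤ ψ * n / 2 := by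
        have : ψ^2 * n ≤ ψ * n := by gcongr; linarith
        linarith
      have hpos : 0 < ψ ^ 2 / 2 * n := by positivity
      have hlt := hcut (A ∪ B) (W \ (A ∪ B))
        (Finset.union_sdiff_of_subset (Finset.union_subset hAW hBW))
        Finset.disjoint_sdiff
        (by rw [← Finset.card_pos]; have : (0:ℝ) < ((A ∪ B).card : ℝ) := by linarith
            exact_mod_cast this)
        (by rw [← Finset.card_pos]; have : (0:ℝ) < ((W \ (A ∪ B)).card : ℝ) := by linarith
            exact_mod_cast this) (ψ ^ 2 / 2 * n) hABc (by linarith)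
      have l2 := eW_subadd_left h0 A B (W \ (A ∪ B))
      have l3 : eW a A (W \ (A ∪ B)) ≤ eW a A (W \ B) :=
        eW_mono h0 subset_rfl (Finset.sdiff_subset_sdiff subset_rfl Finset.subset_union_right)
      have l4 : eW a B (W \ (A ∪ B)) ≤ eW a B (W \ A) :=
        eW_mono h0 subset_rfl (Finset.sdiff_subset_sdiff subset_rfl Finset.subset_union_left)
      have : (ψ^3/2) * n^2 < (3 * η) * n^2 := by linarith
      have := lt_of_mul_lt_mul_right this hn2.le
      have : 0 < ψ^3 := by positivity
      linarith
    have hb := hnb (A \ B) (W \ (A \ B))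
      (Finset.union_sdiff_of_subset (Finset.sdiff_subset.trans hAW)) Finset.disjoint_sdiff
    have l1 : eW a (A \ B) (A \ B) ≤ eW a A (W \ B) :=
      eW_mono h0 Finset.sdiff_subset (Finset.sdiff_subset_sdiff hAW subset_rfl)
    set Q := (A ∩ B) ∪ (W \ (A ∪ B)) with hQ
    have hQc : (Q.card : ℝ) ≤ ψ * n := by
      have : (Q.card : ℝ) ≤ (A ∩ B).card + (W \ (A ∪ B)).card := by
        exact_mod_cast Finset.card_union_le _ _
      linarith
    have hT : W \ (A \ B) ⊆ (B \ A) ∪ Q := by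
      intro v
      simp only [hQ, Finset.mem_sdiff, Finset.mem_union, Finset.mem_inter]; tauto
    have l2 := eW_mono h0 hT (subset_refl (W \ (A \ B)))
    have l3 := eW_subadd_left h0 (B \ A) Q (W \ (A \ B))
    have l4 := eW_mono h0 (subset_refl (B \ A)) hT
    have l5 := eW_subadd_right h0 (B \ A) Q (B \ A)
    have l6 : eW a (B \ A) (B \ A) ≤ eW a B (W \ A) :=
      eW_mono h0 Finset.sdiff_subset (Finset.sdiff_subset_sdiff hBW subset_rfl)
    have l7 : eW a (B \ A) Q ≤ n * (ψ * n) := by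
      refine (eW_le h1 _ _).trans ?_
      gcongr
      exact le_trans (by exact_mod_cast Finset.card_le_card Finset.sdiff_subset) (hcW (2*s+1))
    have l8 : eW a Q (W \ (A \ B)) ≤ (ψ * n) * n := by
      refine (eW_le h1 _ _).trans ?_
      gcongr
      exact le_trans (by exact_mod_cast Finset.card_le_card Finset.sdiff_subset) hW
    have : (1/18 - 2 * ψ) * n^2 ≤ (3 * η + 2 * ψ) * n^2 := by linarith
    have := le_of_mul_le_mul_right this hn2
    linarith
  have all1 : ∀ m, 2*s+1 ≤ m → X m = W := by
    intro m hm
    induction m, hm using Nat.le_induction with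
    | base =>
      refine Finset.Subset.antisymm (hsub _) fun v hv => hgrow _ v hv ?_
      have d1 := hdeg v hv
      have d2 : eW a {v} W ≤ eW a {v} (W \ (A ∩ B)) + eW a {v} A := by
        refine (eW_mono h0 subset_rfl ?_).trans (eW_subadd_right h0 _ _ _)
        intro u; simp only [Finset.mem_sdiff, Finset.mem_union, Finset.mem_inter]; tauto
      have d3 := eW_le h1 {v} (W \ (A ∩ B))
      simp only [Finset.card_singleton, Nat.cast_one, one_mul] at d3
      have : η * n ≤ (ψ / 2) * n := by gcongr; linarith
      linarith
    | succ m hm ih =>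
      refine Finset.Subset.antisymm (hsub _) fun v hv => hgrow _ v hv ?_
      rw [ih]
      refine le_trans ?_ (hdeg v hv)
      gcongr
      linarith
  have hzX : z ∈ X (2*t+1) := by rw [all1 _ (by omega)]; exact hz
  exact (mem_XS.1 hzX).2

end conn
section lists
variable {V : Type*} [DecidableEq V]

/-- lists of vertices of walks, from `v` to `y` -/
noncomputable def WL (r : V → V → Prop) [DecidableRel r] (W : Finset V) (y : V) :
    ℕ → V → Finset (List V)
  | 0, v => if v = y then {[y]} else ∅
  | (i + 1), v => (W.filter (r v)).biUnion fun u => (WL r W y i u).image (v :: ·)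

variable {r : V → V → Prop} [DecidableRel r] {W : Finset V} {y : V}

lemma mem_WL_succ {i : ℕ} {v : V} {l : List V} :
    l ∈ WL r W y (i+1) v ↔ ∃ u ∈ W, r v u ∧ ∃ l' ∈ WL r W y i u, v :: l' = l := by
  simp [WL, and_assoc]

lemma WL_head : ∀ {i : ℕ} {v : V} {l : List V}, l ∈ WL r W y i v → l.head? = some v
  | 0, v, l, h => by
    simp only [WL] at h
    split_ifs at h with h1
    · simp at h; simp [h, h1]
    · simp at h
  | (i+1), v, l, h => by
    rw [mem_WL_succ] at h
    obtain ⟨u, _, _, l', _, rfl⟩ := h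
    rfl

lemma WL_props : ∀ {i : ℕ} {v : V} {l : List V}, v ∈ W → l ∈ WL r W y i v →
    l.length = i + 1 ∧ (∀ x ∈ l, x ∈ W) ∧ l.getLast? = some y ∧ l.IsChain r
  | 0, v, l, hv, h => by
    simp only [WL] at h
    split_ifs at h with h1
    · simp at h; subst h; subst h1; simp [hv]
    · simp at h
  | (i+1), v, l, hv, h => by
    rw [mem_WL_succ] at h
    obtain ⟨u, hu, hr, l', hl', rfl⟩ := h
    obtain ⟨e1, e2, e3, e4⟩ := WL_props hu hl'
    have hh := WL_head hl'
    refine ⟨by simp [e1], ?_, ?_, ?_⟩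
    · intro x hx
      rcases List.mem_cons.1 hx with rfl | hx
      · exact hv
      · exact e2 x hx
    · rw [List.getLast?_cons, e3]; rfl
    · cases l' with
      | nil => simp at e1
      | cons b l'' =>
        simp at hh; subst hh
        exact List.IsChain.cons_cons hr e4

lemma WL_filter_card (i : ℕ) (v : V) (p : List V → Prop) [DecidablePred p] :
    ((WL r W y (i+1) v).filter p).card =
      ∑ u ∈ W.filter (r v), ((WL r W y i u).filter fun l => p (v :: l)).card := by
  have : (WL r W y (i+1) v).filter p = (W.filter (r v)).biUnion fun u =>
      ((WL r W y i u).filter fun l => p (v :: l)).image (v :: ·) := by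
    ext l
    simp only [Finset.mem_filter, mem_WL_succ, Finset.mem_biUnion, Finset.mem_image]
    constructor
    · rintro ⟨⟨u, hu, hr, l', hl', rfl⟩, hp⟩
      exact ⟨u, ⟨hu, hr⟩, l', ⟨hl', hp⟩, rfl⟩
    · rintro ⟨u, ⟨hu, hr⟩, l', ⟨hl', hp⟩, rfl⟩
      exact ⟨⟨u, hu, hr, l', hl', rfl⟩, hp⟩
  rw [this, Finset.card_biUnion]
  · refine Finset.sum_congr rfl fun u _ => ?_
    rw [Finset.card_image_of_injective _ (List.cons_injective)]
  · intro u _ u' _ hne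
    change Disjoint _ _
    rw [Finset.disjoint_left]
    intro l hl hl'
    simp only [Finset.mem_image, Finset.mem_filter] at hl hl'
    obtain ⟨l1, ⟨h1, _⟩, rfl⟩ := hl
    obtain ⟨l2, ⟨h2, _⟩, h3⟩ := hl'
    have : l2 = l1 := by simpa using h3
    subst this
    have := WL_head h1
    rw [WL_head h2] at this
    exact hne (by simpa using this.symm)

lemma WL_card (i : ℕ) : ∀ v, ((WL r W y i v).card : ℝ) =
    fw (fun u v => if r u v then (1:ℝ) else 0) W y i v := by
  induction i with
  | zero => intro v; simp only [WL, fw]; split_ifs <;> simp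
  | succ i ih =>
    intro v
    have := WL_filter_card (r := r) (W := W) (y := y) i v (fun _ => True)
    simp only [Finset.filter_true] at this
    rw [this, fw]
    push_cast
    rw [Finset.sum_filter]
    refine Finset.sum_congr rfl fun u _ => ?_
    split_ifs <;> simp [ih]

lemma WL_total {n : ℝ} (hn : (W.card : ℝ) ≤ n) (i : ℕ) :
    ∑ u ∈ W, ((WL r W y i u).card : ℝ) ≤ n ^ i := by
  cases i with
  | zero =>
    simp only [WL_card, fw, pow_zero, Finset.sum_ite_eq']
    split_ifs <;> norm_num
  | succ i =>
    have hn0 : 0 ≤ n := le_trans (by positivity) hn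
    refine (Finset.sum_le_card_nsmul _ _ (n^i) fun u _ => ?_).trans ?_
    · rw [WL_card]
      exact fw_le (fun u v => by split_ifs <;> norm_num) (fun u v => by split_ifs <;> norm_num)
        W y hn i u
    · rw [nsmul_eq_mul, pow_succ, mul_comm]; gcongr

lemma WL_hit {n : ℝ} (hn : (W.card : ℝ) ≤ n) {v : V} (hv : v ≠ y) (i : ℕ) :
    n * ∑ u ∈ W, (((WL r W y i u).filter fun l => v ∈ l).card : ℝ) ≤ i * n ^ i := by
  have hn0 : 0 ≤ n := le_trans (by positivity) hn
  induction i with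
  | zero =>
    have : ∀ u ∈ W, (((WL r W y 0 u).filter fun l => v ∈ l).card : ℝ) = 0 := by
      intro u _
      rw [Nat.cast_eq_zero, Finset.card_eq_zero, Finset.filter_eq_empty_iff]
      intro l hl
      simp only [WL] at hl
      split_ifs at hl
      · simp at hl; simp [hl, hv]
      · simp at hl
    rw [Finset.sum_eq_zero this]; simp
  | succ i ih =>
    obtain ⟨Hc, hHc⟩ : ∃ Hc, Hc = ∑ u ∈ W, (((WL r W y i u).filter fun l => v ∈ l).card : ℝ) :=
      ⟨_, rfl⟩
    rw [← hHc] at ih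
    have hH0 : 0 ≤ Hc := hHc ▸ Finset.sum_nonneg fun _ _ => Nat.cast_nonneg _
    have key : ∀ u ∈ W, (((WL r W y (i+1) u).filter fun l => v ∈ l).card : ℝ) ≤
        Hc + if u = v then n ^ i else 0 := by
      intro u _
      rw [WL_filter_card]
      push_cast
      by_cases huv : u = v
      · rw [if_pos huv]
        have h1 : ∑ u' ∈ W.filter (r u), (((WL r W y i u').filter fun l => v ∈ u :: l).card : ℝ)
            ≤ ∑ u' ∈ W, ((WL r W y i u').card : ℝ) := by
          refine le_trans (Finset.sum_le_sum fun u' _ => ?_)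
            (Finset.sum_le_sum_of_subset_of_nonneg (Finset.filter_subset _ _)
              fun _ _ _ => Nat.cast_nonneg _)
          exact_mod_cast Finset.card_filter_le _ _
        have := WL_total (r := r) (W := W) (y := y) hn i
        linarith
      · rw [if_neg huv, add_zero, hHc]
        refine le_trans (Finset.sum_le_sum fun u' _ => ?_)
            (Finset.sum_le_sum_of_subset_of_nonneg (Finset.filter_subset _ _)
              fun _ _ _ => Nat.cast_nonneg _)
        have : v ≠ u := fun h => huv h.symm
        simp [this]
    have h2 : ∑ u ∈ W, (((WL r W y (i+1) u).filter fun l => v ∈ l).card : ℝ) ≤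
        n * Hc + n ^ i := by
      refine (Finset.sum_le_sum key).trans ?_
      rw [Finset.sum_add_distrib, Finset.sum_const, nsmul_eq_mul, Finset.sum_ite_eq']
      apply add_le_add
      · gcongr
      · split_ifs
        · exact le_rfl
        · positivity
    calc _ ≤ n * (n * Hc + n ^ i) := by gcongr
      _ ≤ n * (i * n^i + n^i) := by gcongr
      _ = _ := by push_cast; ring

lemma WL_bad {n : ℝ} (hn : (W.card : ℝ) ≤ n) (hn1 : 0 ≤ n) (i : ℕ) : ∀ v : V, v ≠ y →
    n^2 * (((WL r W y i v).filter fun l => ¬ l.Nodup).card : ℝ) ≤ ((i:ℝ)+1)^2 * n ^ i := by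
  have zero : ∀ v, (((WL r W y 0 v).filter fun l => ¬ l.Nodup).card : ℝ) = 0 := by
    intro v
    rw [Nat.cast_eq_zero, Finset.card_eq_zero, Finset.filter_eq_empty_iff]
    intro l hl
    simp only [WL] at hl
    split_ifs at hl
    · simp at hl; simp [hl]
    · simp at hl
  induction i with
  | zero =>
    intro v _
    rw [zero]; norm_num
  | succ i ih =>
    intro v hv
    have hy : n * (((WL r W y i y).filter fun l => ¬ l.Nodup).card : ℝ) ≤ n ^ i := by
      cases i with
      | zero => rw [zero]; norm_num
      | succ j =>
        rw [pow_succ, mul_comm]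
        gcongr
        calc (((WL r W y (j+1) y).filter fun l => ¬ l.Nodup).card : ℝ)
            ≤ ((WL r W y (j+1) y).card : ℝ) := by exact_mod_cast Finset.card_filter_le _ _
          _ ≤ n^j := by
            rw [WL_card]
            exact fw_le (fun u v => by split_ifs <;> norm_num)
              (fun u v => by split_ifs <;> norm_num) W y hn j y
    have h1 : (((WL r W y (i+1) v).filter fun l => ¬ l.Nodup).card : ℝ) ≤
        ∑ u ∈ W, (((WL r W y i u).filter fun l => ¬ l.Nodup).card : ℝ) +
        ∑ u ∈ W, (((WL r W y i u).filter fun l => v ∈ l).card : ℝ) := by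
      rw [WL_filter_card]
      push_cast
      rw [← Finset.sum_add_distrib]
      refine le_trans (Finset.sum_le_sum fun u' _ => ?_)
            (Finset.sum_le_sum_of_subset_of_nonneg (Finset.filter_subset _ _)
              fun _ _ _ => add_nonneg (Nat.cast_nonneg _) (Nat.cast_nonneg _))
      rw [← Nat.cast_add, Nat.cast_le]
      refine le_trans (Finset.card_le_card ?_) (Finset.card_union_le _ _)
      intro l
      simp only [Finset.mem_filter, Finset.mem_union, List.nodup_cons]
      tauto
    have h2 : n^2 * ∑ u ∈ W, (((WL r W y i u).filter fun l => ¬ l.Nodup).card : ℝ) ≤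
        n * (((i:ℝ)+1)^2 * n^i) + n * n^i := by
      rw [Finset.mul_sum]
      have : ∀ u ∈ W, n^2 * (((WL r W y i u).filter fun l => ¬ l.Nodup).card : ℝ) ≤
          ((i:ℝ)+1)^2 * n^i + if u = y then n * n^i else 0 := by
        intro u _
        by_cases huy : u = y
        · rw [if_pos huy, huy]
          have q : 0 ≤ ((i:ℝ)+1)^2 * n^i := by positivity
          have : n * (n * (((WL r W y i y).filter fun l => ¬ l.Nodup).card : ℝ)) ≤ n * n^i := by
            gcongr
          linarith
        · rw [if_neg huy, add_zero]; exact ih u huy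
      refine (Finset.sum_le_sum this).trans ?_
      rw [Finset.sum_add_distrib, Finset.sum_const, nsmul_eq_mul, Finset.sum_ite_eq']
      apply add_le_add
      · gcongr
      · split_ifs
        · exact le_rfl
        · positivity
    have h3 := WL_hit (r := r) (W := W) (y := y) hn hv i
    have h3' := mul_le_mul_of_nonneg_left h3 hn1
    have h1' := mul_le_mul_of_nonneg_left h1 (by positivity : 0 ≤ n^2)
    have q : 0 ≤ n * n^i := by positivity
    have e : (((i+1 : ℕ) : ℝ) + 1)^2 * n^(i+1) = n * (((i:ℝ)+1)^2 * n^i) + n * n^i +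
      n * (i * n^i) + ((i:ℝ) + 2) * (n * n^i) := by push_cast; ring
    rw [e]
    have q2 : 0 ≤ ((i:ℝ) + 2) * (n * n^i) := by positivity
    linarith

end lists
section final

lemma graph_lemma (α μ : ℝ) (hα : 0 < α) (hμ : 0 < μ) :
    ∃ β : ℝ, 0 < β ∧ ∃ ℓ : ℕ, Odd ℓ ∧ 3 ≤ ℓ ∧ ∃ n₀ : ℕ,
      ∀ (V : Type) [Fintype V] [DecidableEq V] (L : Finset (Finset V)),
        n₀ ≤ Fintype.card V →
        (∀ e ∈ L, e.card = 2) →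
        (5 / 9 + α) * (Fintype.card V : ℝ) ^ 2 / 2 ≤ (L.card : ℝ) →
        ∃ W : Finset V, (2 / 3 + α / 2) * (Fintype.card V : ℝ) ≤ W.card ∧
          (((L.filter fun p => (p ∩ W).Nonempty ∧ (p \ W).Nonempty).card : ℝ)
            ≤ μ * (Fintype.card V : ℝ) ^ 2) ∧
          ∀ y ∈ W, ∀ z ∈ W, y ≠ z →
            β * (Fintype.card V : ℝ) ^ (ℓ - 1) ≤
            (({ l : List V | l.length = ℓ + 1 ∧ l.Nodup ∧ (∀ v ∈ l, v ∈ W) ∧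
              l.head? = some y ∧ l.getLast? = some z ∧
              l.IsChain (fun u v => ({u, v} : Finset V) ∈ L) } : Set (List V)).ncard : ℝ) := by
  obtain ⟨ψ, hψ, hψ1, hψα, hψμ⟩ : ∃ ψ : ℝ, 0 < ψ ∧ ψ ≤ 1/200 ∧ ψ ≤ α / 9 ∧ ψ ≤ μ :=
    ⟨min (1/200) (min (α/9) μ), by positivity, min_le_left _ _,
      (min_le_right _ _).trans (min_le_left _ _), (min_le_right _ _).trans (min_le_right _ _)⟩
  obtain ⟨η, hη⟩ : ∃ η : ℝ, η = ψ^3/10 := ⟨_, rfl⟩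
  have hηp : 0 < η := by rw [hη]; positivity
  obtain ⟨t, ht⟩ := exists_nat_gt (2 / η)
  set b := bseq η (2*t+1) with hb
  have hbp : 0 < b := bseq_pos hηp _
  obtain ⟨n₁, hn₁⟩ := exists_nat_gt (2 * ((2*t+3 : ℕ) + 1 : ℝ)^2 / b)
  refine ⟨b/2, by positivity, 2*t+3, ⟨t+1, by ring⟩, by omega, max n₁ 3, ?_⟩
  intro V _ _ L hnV hL2 hLc
  have hn3 : 3 ≤ Fintype.card V := (le_max_right _ _).trans hnV
  have hnn1 : n₁ ≤ Fintype.card V := (le_max_left _ _).trans hnV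
  obtain ⟨n, hn⟩ : ∃ n : ℝ, n = (Fintype.card V : ℝ) := ⟨_, rfl⟩
  have hnp : 0 < n := by rw [hn]; exact_mod_cast (by omega : 0 < Fintype.card V)
  let r : V → V → Prop := fun u v => ({u, v} : Finset V) ∈ L
  set a : V → V → ℝ := fun u v => if r u v then (1:ℝ) else 0 with ha
  have h01 : ∀ u v, a u v = 0 ∨ a u v = 1 := by
    intro u v; simp only [ha]; split_ifs <;> simp
  have h0 : ∀ u v, 0 ≤ a u v := fun u v => by rcases h01 u v with h | h <;> rw [h]; norm_num
  have h1 : ∀ u v, a u v ≤ 1 := fun u v => by rcases h01 u v with h | h <;> rw [h]; norm_num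
  have hs : ∀ u v, a u v = a v u := by
    intro u v; simp only [ha, r, Finset.pair_comm]
  have heW : ∀ S T : Finset V, eW a S T =
      (((S ×ˢ T).filter fun p => ({p.1, p.2} : Finset V) ∈ L).card : ℝ) := by
    intro S T
    rw [Finset.card_filter, Finset.sum_product]
    push_cast
    rfl
  have he : (5/9 + α) * (Fintype.card V : ℝ)^2 ≤ eW a univ univ := by
    have : 2 * L.card ≤ (((univ : Finset V) ×ˢ (univ : Finset V)).filter
        fun p => ({p.1, p.2} : Finset V) ∈ L).card := by
      refine Finset.mul_card_image_le_card_of_maps_to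
        (f := fun p : V × V => ({p.1, p.2} : Finset V)) (fun p hp => (Finset.mem_filter.1 hp).2) 2 ?_
      intro e he
      obtain ⟨u, v, huv, rfl⟩ := Finset.card_eq_two.1 (hL2 e he)
      have hpair : ({(u, v), (v, u)} : Finset (V × V)).card = 2 :=
        Finset.card_pair (fun h => huv (congrArg Prod.fst h))
      rw [← hpair]
      apply Finset.card_le_card
      intro p hp
      simp only [Finset.mem_insert, Finset.mem_singleton] at hp
      rcases hp with rfl | rfl
      · simp [he]
      · simp [Finset.pair_comm v u, he]
    rw [heW]
    have h2 : (2:ℝ) * L.card ≤ ((((univ : Finset V) ×ˢ (univ : Finset V)).filter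
        fun p => ({p.1, p.2} : Finset V) ∈ L).card : ℝ) := by exact_mod_cast this
    linarith
  obtain ⟨W, hW1, hW2, hW3⟩ := extraction hs h0 h1 hα hψ hψα (by omega) he
  have hnb := nonbip hs h1 hα hψ he W hW1 hW2
  rw [← hn] at hLc he hW1 hW2 hW3 hnb ⊢
  have hWn : (W.card : ℝ) ≤ n := by rw [hn]; exact_mod_cast Finset.card_le_univ W
  have hWc : ((Wᶜ).card : ℝ) ≤ n := by rw [hn]; exact_mod_cast Finset.card_le_univ _
  refine ⟨W, hW1, ?_, ?_⟩
  · have h2 : (L.filter fun p => (p ∩ W).Nonempty ∧ (p \ W).Nonempty) ⊆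
        ((W ×ˢ Wᶜ).filter fun p => ({p.1, p.2} : Finset V) ∈ L).image
          fun p => ({p.1, p.2} : Finset V) := by
      intro p hp
      rw [Finset.mem_filter] at hp
      obtain ⟨hpL, ⟨u, hu⟩, ⟨v, hv⟩⟩ := hp
      rw [Finset.mem_inter] at hu
      rw [Finset.mem_sdiff] at hv
      have huv : u ≠ v := fun h => hv.2 (h ▸ hu.2)
      have hpe : ({u, v} : Finset V) = p := by
        apply Finset.eq_of_subset_of_card_le
        · intro x hx
          simp only [Finset.mem_insert, Finset.mem_singleton] at hx
          rcases hx with rfl | rfl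
          · exact hu.1
          · exact hv.1
        · rw [hL2 p hpL, Finset.card_pair huv]
      rw [Finset.mem_image]
      refine ⟨(u, v), ?_, hpe⟩
      simp [hu.2, hv.2, hpe, hpL]
    have h3 : ((L.filter fun p => (p ∩ W).Nonempty ∧ (p \ W).Nonempty).card : ℝ) ≤
        eW a W Wᶜ := by
      rw [heW]
      exact_mod_cast (Finset.card_le_card h2).trans Finset.card_image_le
    calc _ ≤ _ := h3
      _ ≤ _ := hW2
      _ ≤ ψ * n * n := by gcongr
      _ ≤ μ * n * n := by gcongr
      _ = _ := by ring
  · intro y hy z hz hyz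
    have hdeg : ∀ v ∈ W, ψ * n ≤ eW a {v} W := by
      intro v hv
      have hc : (1:ℝ) ≤ ((W \ {v}).card : ℝ) := by
        have hn3' : (3:ℝ) ≤ n := by rw [hn]; exact_mod_cast hn3
        have h2 : (1:ℝ) < W.card := by
          have := mul_pos hα hnp
          linarith
        have h3 : 1 < W.card := by exact_mod_cast h2
        have h4 : 1 ≤ (W \ {v}).card := by
          rw [Finset.card_sdiff_of_subset (by simpa using hv)]; simp; omega
        exact_mod_cast h4
      have := hW3 {v} (W \ {v}) (Finset.union_sdiff_of_subset (by simpa using hv))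
        Finset.disjoint_sdiff (by simp)
        (by rw [← Finset.card_pos]; exact_mod_cast (by linarith : (0:ℝ) < ((W \ {v}).card : ℝ)))
        1 (by simp) hc
      have h2 : eW a {v} (W \ {v}) ≤ eW a {v} W := eW_mono h0 subset_rfl Finset.sdiff_subset
      linarith
    have hwalk := walks_many h01 hs hψ hψ1 hη hnp hWn hdeg hW3 hnb t ht hz hy
    rw [← hb, ← WL_card (r := r)] at hwalk
    have hbad := WL_bad (r := r) (W := W) (y := z) hWn hnp.le (2*t+3) y hyz
    have hsplit := Finset.card_filter_add_card_filter_not (s := WL r W z (2*t+3) y)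
      (fun l => l.Nodup)
    have hsplit' : (((WL r W z (2*t+3) y).filter fun l => l.Nodup).card : ℝ) +
      (((WL r W z (2*t+3) y).filter fun l => ¬ l.Nodup).card : ℝ) =
        ((WL r W z (2*t+3) y).card : ℝ) := by exact_mod_cast hsplit
    have hle : (((WL r W z (2*t+3) y).filter fun l => ¬ l.Nodup).card : ℝ) ≤
        b/2 * n^(2*t+2) := by
      have hn1' : 2 * ((2*t+3 : ℕ) + 1 : ℝ)^2 / b < n :=
        hn₁.trans_le (by rw [hn]; exact_mod_cast hnn1)
      rw [div_lt_iff₀ hbp] at hn1'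
      have : n^2 * (((WL r W z (2*t+3) y).filter fun l => ¬ l.Nodup).card : ℝ) ≤
          n^2 * (b/2 * n^(2*t+2)) := by
        calc _ ≤ _ := hbad
          _ ≤ (n * b / 2) * n^(2*t+3) := by
            gcongr
            linarith
          _ = _ := by ring
      exact le_of_mul_le_mul_left this (by positivity)
    have hgood : b / 2 * n^(2*t+3-1) ≤
        (((WL r W z (2*t+3) y).filter fun l => l.Nodup).card : ℝ) := by
      have : 2*t+3-1 = 2*t+2 := by omega
      rw [this]
      linarith
    refine hgood.trans ?_
    rw [Nat.cast_le, ← Set.ncard_coe_finset]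
    apply Set.ncard_le_ncard
    · intro l hl
      rw [Finset.mem_coe, Finset.mem_filter] at hl
      obtain ⟨e1, e2, e3, e4⟩ := WL_props hy hl.1
      exact ⟨e1, hl.2, e2, WL_head hl.1, e3, e4⟩
    · exact (List.finite_length_eq V (2*t+3+1)).subset fun l hl => hl.1

end final
/-- Fact 2.28: for all `k ≥ 2` and `α, μ > 0` there exist `β > 0` and an odd `ℓ ≥ 3` such that
every sufficiently large `k`-uniform hypergraph `H` with `δ_{k-2}(H) ≥ (5/9 + α) n²/2` expands
to an `(α, β, ℓ, μ)`-constellation. -/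
theorem stmt15 (k : ℕ) (hk : 2 ≤ k) (α μ : ℝ) (hα : 0 < α) (hμ : 0 < μ) :
    ∃ β : ℝ, 0 < β ∧ ∃ ℓ : ℕ, Odd ℓ ∧ 3 ≤ ℓ ∧ ∃ n₀ : ℕ,
      ∀ (V : Type) [Fintype V] [DecidableEq V] (E : Finset (Finset V)),
        n₀ ≤ Fintype.card V →
        (∀ e ∈ E, e.card = k) →
        (∀ S : Finset V, S.card = k - 2 →
          (5 / 9 + α) * (Fintype.card V : ℝ) ^ 2 / 2 ≤ ((E.filter fun e => S ⊆ e).card : ℝ)) →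
        ∃ W : Finset V → Finset V,
          IsConst k (⟨Finset.univ, E, W⟩ : Constellation V) α β ℓ μ := by
  obtain ⟨β, hβ, ℓ, hodd, hℓ, n₀, H⟩ := graph_lemma α μ hα hμ
  refine ⟨β, hβ, ℓ, hodd, hℓ, n₀, ?_⟩
  intro V _ _ E hn hE hdeg
  have key : ∀ x : Finset V, ∃ Wx : Finset V, x.card = k - 2 →
      (2 / 3 + α / 2) * (Fintype.card V : ℝ) ≤ Wx.card ∧
      ((((((E.filter fun e => x ⊆ e).image (· \ x))).filter
          fun p => (p ∩ Wx).Nonempty ∧ (p \ Wx).Nonempty).card : ℝ)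
            ≤ μ * (Fintype.card V : ℝ) ^ 2) ∧
      ∀ y ∈ Wx, ∀ z ∈ Wx, y ≠ z →
            β * (Fintype.card V : ℝ) ^ (ℓ - 1) ≤
            (({ l : List V | l.length = ℓ + 1 ∧ l.Nodup ∧ (∀ v ∈ l, v ∈ Wx) ∧
              l.head? = some y ∧ l.getLast? = some z ∧
              l.IsChain (fun u v => ({u, v} : Finset V) ∈
                (E.filter fun e => x ⊆ e).image (· \ x)) } : Set (List V)).ncard : ℝ) := by
    intro x
    by_cases hx : x.card = k - 2
    · obtain ⟨Wx, h⟩ := H V ((E.filter fun e => x ⊆ e).image (· \ x)) hn (by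
        intro p hp
        rw [Finset.mem_image] at hp
        obtain ⟨e, he, rfl⟩ := hp
        rw [Finset.mem_filter] at he
        rw [Finset.card_sdiff_of_subset he.2, hE e he.1, hx]
        omega) (by
        rw [Finset.card_image_of_injOn]
        · exact hdeg x hx
        · intro e he e' he' hee
          rw [Finset.mem_coe, Finset.mem_filter] at he he'
          have hee' : e \ x = e' \ x := hee
          rw [← Finset.sdiff_union_of_subset he.2, hee', Finset.sdiff_union_of_subset he'.2])
      exact ⟨Wx, fun _ => h⟩
    · exact ⟨∅, fun h => absurd h hx⟩
  choose W hW using key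
  refine ⟨W, ⟨?_, ?_⟩, ?_⟩
  · intro e he
    exact ⟨Finset.subset_univ _, hE e he⟩
  · intro x _ hx
    obtain ⟨h1, h2, _⟩ := hW x hx
    refine ⟨?_, Finset.subset_univ _, ?_, ?_⟩
    · simpa only [Finset.card_univ] using hdeg x hx
    · simpa only [Finset.card_univ] using h1
    · change _ ≤ μ * ((Finset.univ : Finset V).card : ℝ) ^ 2
      rw [Finset.card_univ]; exact h2
  · intro x _ hx y hy z hz hyz
    have h3 := (hW x hx).2.2 y hy z hz hyz
    change β * ((Finset.univ : Finset V).card : ℝ) ^ (ℓ - 1) ≤ _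
    rw [Finset.card_univ]; exact h3
end

section
/- Let k ≥ 4, α > 0, and ζ ∈ (0, 3^{−(k+2)}]. Then there exists n₀ such that for every k-uniform (α, α/10)-constellation Ψ on n ≥ n₀ vertices and any two sets U, W ⊆ V(Ψ) with |U|, |W| ≥ ζn, the number of (2k−2)-tuples (u, q₁,…,q_{2k−4}, w) ∈ V(Ψ)^{2k−2} such that u ∈ U and w ∈ W are distinct, q₁…q_{2k−4} is a walk in the link hypergraph H(Ψ_{uw}), (q₁,…,q_{k−2}) is ζ³-rightconnectable in Ψ_u, and (q_{k−1},…,q_{2k−4}) is ζ³-leftconnectable in Ψ_w, is at least ζ³·n^{2k−2}. -/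
open Finset

/-! ### A Sidorenko type counting lemma -/

lemma sid_count {Ω : Type*} [DecidableEq Ω] (F : Finset Ω) (r : ℕ) (π : ℕ → Ω → Ω) (M : ℝ)
    (hM0 : 0 < M)
    (hM : ∀ j < r, ((F.image (π j)).card : ℝ) ≤ M) (N : ℕ → Ω → ℝ)
    (h0 : ∀ x ∈ F, 1 ≤ N 0 x)
    (hs : ∀ j < r, ∀ y ∈ F, ∑ x ∈ F with π j x = π j y, N j x ≤ N (j + 1) y) :
    (F.card : ℝ) * (F.card / M) ^ r ≤ ∑ x ∈ F, N r x := by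
  rcases F.eq_empty_or_nonempty with rfl | hF
  · simp
  have hFc : (0 : ℝ) < F.card := by exact_mod_cast hF.card_pos
  obtain ⟨c, hc⟩ : ∃ c : ℝ, c = F.card / M := ⟨_, rfl⟩
  have hc0 : 0 < c := by rw [hc]; positivity
  have hcM : c * M = F.card := by rw [hc]; field_simp
  have key : ∀ j ≤ r, (∀ x ∈ F, 1 ≤ N j x) ∧
      (j : ℝ) * F.card * Real.log c ≤ ∑ x ∈ F, Real.log (N j x) := by
    intro j
    induction j with
    | zero =>
      intro _
      refine ⟨h0, ?_⟩
      simp only [Nat.cast_zero, zero_mul]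
      exact Finset.sum_nonneg fun x hx => Real.log_nonneg (h0 x hx)
    | succ j ih =>
      intro hj
      obtain ⟨h1, h2⟩ := ih (by omega)
      have hSge : ∀ y ∈ F, N j y ≤ ∑ x ∈ F with π j x = π j y, N j x := by
        intro y hy
        refine Finset.single_le_sum (f := fun x => N j x) (fun x hx => ?_) ?_
        · have := h1 x (Finset.mem_filter.1 hx).1; linarith
        · simp [hy]
      have hpos : ∀ y ∈ F, 1 ≤ ∑ x ∈ F with π j x = π j y, N j x :=
        fun y hy => (h1 y hy).trans (hSge y hy)
      refine ⟨fun y hy => (hpos y hy).trans (hs j (by omega) y hy), ?_⟩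
      have hlog : ∑ y ∈ F, Real.log (∑ x ∈ F with π j x = π j y, N j x) ≤
          ∑ y ∈ F, Real.log (N (j + 1) y) := by
        refine Finset.sum_le_sum fun y hy => ?_
        exact Real.log_le_log (by linarith [hpos y hy]) (hs j (by omega) y hy)
      have hlines : ∑ y ∈ F, N j y / (∑ x ∈ F with π j x = π j y, N j x) =
          (F.image (π j)).card := by
        rw [← Finset.sum_fiberwise_of_maps_to (t := F.image (π j)) (g := π j)
          (fun x hx => Finset.mem_image_of_mem _ hx)]
        rw [Finset.card_eq_sum_ones, Nat.cast_sum]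
        refine Finset.sum_congr rfl fun l hl => ?_
        obtain ⟨y, hy, rfl⟩ := Finset.mem_image.1 hl
        have : ∀ z ∈ F.filter (fun x => π j x = π j y),
            N j z / (∑ x ∈ F with π j x = π j z, N j x) =
            N j z / (∑ x ∈ F with π j x = π j y, N j x) := by
          intro z hz
          rw [(Finset.mem_filter.1 hz).2]
        rw [Finset.sum_congr rfl this, ← Finset.sum_div, div_self]
        · simp
        · linarith [hpos y hy]
      have htan : ∀ y ∈ F, Real.log (N j y) + Real.log c -
          Real.log (∑ x ∈ F with π j x = π j y, N j x) ≤
          c * (N j y / (∑ x ∈ F with π j x = π j y, N j x)) - 1 := by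
        intro y hy
        have a1 := h1 y hy
        have a2 := hpos y hy
        have a3 : 0 < N j y := by linarith
        have a4 : 0 < ∑ x ∈ F with π j x = π j y, N j x := by linarith
        have := Real.log_le_sub_one_of_pos
          (show 0 < N j y * c / (∑ x ∈ F with π j x = π j y, N j x) by positivity)
        rw [Real.log_div (by positivity) (by positivity),
          Real.log_mul (by positivity) (by positivity)] at this
        calc _ ≤ _ := this
          _ = _ := by ring
      have hsum := Finset.sum_le_sum htan
      rw [Finset.sum_sub_distrib, Finset.sum_add_distrib, Finset.sum_sub_distrib,
        ← Finset.mul_sum, hlines] at hsum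
      simp only [Finset.sum_const, nsmul_eq_mul, mul_one] at hsum
      have := mul_le_mul_of_nonneg_left (hM j (by omega)) hc0.le
      push_cast
      nlinarith
  obtain ⟨h1, h2⟩ := key r le_rfl
  rw [← hc]
  have htan : ∀ y ∈ F, Real.log (N r y) - r * Real.log c ≤ N r y / c ^ r - 1 := by
    intro y hy
    have a3 : 0 < N r y := by linarith [h1 y hy]
    have := Real.log_le_sub_one_of_pos (show 0 < N r y / c ^ r by positivity)
    rwa [Real.log_div (by positivity) (by positivity), Real.log_pow] at this
  have hsum := Finset.sum_le_sum htan
  rw [Finset.sum_sub_distrib, Finset.sum_sub_distrib, ← Finset.sum_div] at hsum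
  simp only [Finset.sum_const, nsmul_eq_mul, mul_one] at hsum
  have : (F.card : ℝ) ≤ (∑ x ∈ F, N r x) / c ^ r := by nlinarith
  rwa [le_div_iff₀ (by positivity)] at this

/-! ### Bad tuples -/

section Bad

variable {V : Type} [Fintype V] [DecidableEq V]

open Classical in
noncomputable def badF (m : ℕ) (Φ : Constellation V) (ζ : ℝ) : Finset (Fin m → V) :=
  univ.filter fun a => univ.image a ∈ Φ.edges ∧ ¬ LeftConn m Φ ζ (List.ofFn a).tail

open Classical in
noncomputable def badP (m : ℕ) (Φ : Constellation V) (ζ : ℝ) (Z : Finset V) :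
    Finset (V × (Fin m → V)) :=
  univ.filter fun p => p.1 ∈ Z ∧ insert p.1 (univ.image p.2) ∈ Φ.edges ∧
    ¬ LeftConn (m + 1) Φ ζ (List.ofFn p.2)

def PairBad (m : ℕ) (Φ : Constellation V) (β : ℝ) : Prop :=
  ∀ x : Finset V, x ⊆ Φ.verts → x.card = m →
    (((univ : Finset (V × V)).filter fun p =>
      insert p.1 (insert p.2 x) ∈ Φ.edges ∧ p.2 ∉ Φ.W x).card : ℝ) ≤ β

lemma mem_link_edges {Φ : Constellation V} {S e : Finset V} :
    e ∈ (Φ.link S).edges ↔ Disjoint S e ∧ S ∪ e ∈ Φ.edges := by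
  simp only [Constellation.link, mem_image, mem_filter]
  constructor
  · rintro ⟨f, ⟨hf, hS⟩, rfl⟩
    refine ⟨disjoint_sdiff, ?_⟩
    rwa [union_sdiff_of_subset hS]
  · rintro ⟨hd, he⟩
    refine ⟨_, ⟨he, subset_union_left⟩, ?_⟩
    rw [union_sdiff_left, sdiff_eq_self_of_disjoint hd.symm]

lemma uniform_link {m : ℕ} {Φ : Constellation V} (h : IsUniformConst (m + 1) Φ) (z : V) :
    IsUniformConst m (Φ.link {z}) := by
  intro e he
  obtain ⟨hd, he⟩ := mem_link_edges.1 he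
  obtain ⟨h1, h2⟩ := h _ he
  rw [card_union_of_disjoint hd, card_singleton] at h2
  refine ⟨?_, by omega⟩
  intro v hv
  simp only [Constellation.link, mem_sdiff]
  exact ⟨h1 (mem_union_right _ hv), fun h' => (Finset.disjoint_left.1 hd h' hv)⟩

lemma pairBad_link {m : ℕ} {Φ : Constellation V} {β : ℝ} (h : PairBad (m + 1) Φ β) {z : V}
    (hz : z ∈ Φ.verts) : PairBad m (Φ.link {z}) β := by
  intro x hx hxc
  have hx' : ∀ v ∈ x, v ∈ Φ.verts ∧ v ≠ z := by
    intro v hv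
    have := hx hv
    simpa [Constellation.link] using this
  have hzx : z ∉ x := fun h' => (hx' z h').2 rfl
  refine le_trans ?_ (h (insert z x) ?_ ?_)
  · refine Nat.cast_le.2 (card_le_card ?_)
    intro p
    simp only [mem_filter, mem_univ, true_and]
    rintro ⟨h1, h2⟩
    obtain ⟨hd, he⟩ := mem_link_edges.1 h1
    have e1 : insert p.1 (insert p.2 (insert z x)) = {z} ∪ insert p.1 (insert p.2 x) := by
      ext v; simp only [mem_insert, mem_union, mem_singleton]; tauto
    refine ⟨by rwa [e1], fun h3 => h2 ?_⟩
    have e2 : x ∪ {z} = insert z x := by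
      ext v; simp only [mem_insert, mem_union, mem_singleton]; tauto
    simp only [Constellation.link, mem_sdiff, e2, mem_singleton]
    refine ⟨h3, fun h4 => ?_⟩
    exact Finset.disjoint_left.1 hd (mem_singleton_self z) (by simp [h4])
  · intro v hv
    rcases mem_insert.1 hv with rfl | hv
    · exact hz
    · exact (hx' v hv).1
  · rw [card_insert_of_notMem hzx, hxc]

lemma badP_card {m : ℕ} {Φ : Constellation V} {ζ : ℝ} (hζ : 0 ≤ ζ)
    (h : IsUniformConst (m + 3) Φ) (Z : Finset V) :
    ((badP (m + 2) Φ ζ Z).card : ℝ) ≤ ζ * (Φ.verts.card : ℝ) ^ (m + 3) +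
      ∑ z ∈ Z, ((badF (m + 2) (Φ.link {z}) ζ).card : ℝ) := by
  classical
  set n := Φ.verts.card
  set A : Finset (V × (Fin (m + 2) → V)) := univ.filter fun p =>
    insert p.1 (univ.image p.2) ∈ Φ.edges ∧ ¬ LeftConn (m + 3) Φ ζ (List.ofFn p.2) ∧
      LeftConn (m + 2) (Φ.link {p.1}) ζ (List.ofFn p.2).tail with hA
  set B : Finset (Σ _ : V, (Fin (m + 2) → V)) := Z.sigma fun z => badF (m + 2) (Φ.link {z}) ζ
    with hB
  have hsub : badP (m + 2) Φ ζ Z ⊆ A ∪ B.image (fun s => (s.1, s.2)) := by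
    intro p hp
    simp only [badP, mem_filter, mem_univ, true_and] at hp
    obtain ⟨h1, h2, h3⟩ := hp
    rw [mem_union]
    by_cases hL : LeftConn (m + 2) (Φ.link {p.1}) ζ (List.ofFn p.2).tail
    · left
      simp only [hA, mem_filter, mem_univ, true_and]
      exact ⟨h2, h3, hL⟩
    · right
      refine mem_image.2 ⟨⟨p.1, p.2⟩, ?_, rfl⟩
      simp only [hB, mem_sigma, badF, mem_filter, mem_univ, true_and]
      refine ⟨h1, mem_link_edges.2 ⟨?_, h2⟩, hL⟩
      rw [disjoint_singleton_left]
      intro hmem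
      have hc := (h _ h2).2
      rw [insert_eq_of_mem hmem] at hc
      have : (univ.image p.2).card ≤ m + 2 := by
        simpa using (card_image_le (s := univ) (f := p.2))
      omega
  have hBc : (B.image (fun s => (s.1, s.2))).card ≤
      ∑ z ∈ Z, (badF (m + 2) (Φ.link {z}) ζ).card := by
    refine card_image_le.trans ?_
    rw [hB, card_sigma]
  have hAc : (A.card : ℝ) ≤ ζ * (n : ℝ) ^ (m + 3) := by
    have hmaps : ∀ p ∈ A, p.2 ∈ Fintype.piFinset (fun _ : Fin (m + 2) => Φ.verts) := by
      intro p hp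
      simp only [hA, mem_filter, mem_univ, true_and] at hp
      rw [Fintype.mem_piFinset]
      intro i
      exact (h _ hp.1).1 (mem_insert_of_mem (mem_image_of_mem _ (mem_univ i)))
    rw [card_eq_sum_card_fiberwise hmaps, Nat.cast_sum]
    have hfib : ∀ b ∈ Fintype.piFinset (fun _ : Fin (m + 2) => Φ.verts),
        ((A.filter fun p => p.2 = b).card : ℝ) ≤ ζ * n := by
      intro b _
      by_cases hL : LeftConn (m + 3) Φ ζ (List.ofFn b)
      · have : A.filter (fun p => p.2 = b) = ∅ := by
          rw [filter_eq_empty_iff]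
          rintro p hp rfl
          simp only [hA, mem_filter, mem_univ, true_and] at hp
          exact hp.2.1 hL
        rw [this]; simp only [card_empty, Nat.cast_zero]; positivity
      · have hL' := hL
        rw [LeftConn] at hL'
        simp only [List.length_ofFn, true_and, not_le] at hL'
        refine le_trans ?_ hL'.le
        rw [← Set.ncard_coe_finset, Nat.cast_le]
        refine Set.ncard_le_ncard_of_injOn Prod.fst ?_ ?_ (Set.toFinite _)
        · intro p hp
          simp only [hA, coe_filter, mem_filter, mem_univ, true_and, Set.mem_ofPred_eq] at hp
          obtain ⟨⟨h1, h2, h3⟩, rfl⟩ := hp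
          have e : (List.ofFn p.2).toFinset = univ.image p.2 := by
            ext v; simp only [List.mem_toFinset, List.mem_ofFn', Set.mem_range, mem_image, mem_univ, true_and]
          refine ⟨(h _ h1).1 (mem_insert_self _ _), ?_, h3⟩
          rw [e]; exact h1
        · intro p hp q hq hpq
          simp only [coe_filter, Set.mem_ofPred_eq] at hp hq
          exact Prod.ext hpq (hp.2.trans hq.2.symm)
    refine (Finset.sum_le_sum hfib).trans ?_
    rw [sum_const, Fintype.card_piFinset_const, nsmul_eq_mul]
    push_cast
    apply le_of_eq
    ring
  have := card_le_card hsub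
  have h4 := this.trans (card_union_le _ _)
  have h5 : ((badP (m + 2) Φ ζ Z).card : ℝ) ≤ A.card + ∑ z ∈ Z, ((badF (m + 2) (Φ.link {z}) ζ).card : ℝ) := by
    exact_mod_cast h4.trans (Nat.add_le_add_left hBc _)
  linarith

lemma badF_card (m : ℕ) : ∀ {Φ : Constellation V} {ζ β : ℝ} {n : ℕ}, 0 ≤ ζ → 0 ≤ β →
    IsUniformConst (m + 2) Φ → PairBad m Φ β → Φ.verts.card ≤ n →
    ((badF (m + 2) Φ ζ).card : ℝ) ≤ β * n ^ m + m * ζ * n ^ (m + 2) := by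
  induction m with
  | zero =>
    intro Φ ζ β n hζ hβ hu hp hn
    simp only [pow_zero, mul_one, Nat.cast_zero, zero_mul, add_zero]
    refine le_trans ?_ (hp ∅ (empty_subset _) rfl)
    rw [Nat.cast_le]
    refine card_le_card_of_injOn (fun a => (a 0, a 1)) ?_ ?_
    · intro a ha
      simp only [badF, coe_filter, mem_univ, true_and, Set.mem_ofPred_eq] at ha ⊢
      obtain ⟨h1, h2⟩ := ha
      constructor
      · convert h1 using 1
        ext v
        simp [Fin.exists_fin_two, eq_comm]
      · intro h3
        apply h2
        simp [LeftConn, List.ofFn_succ, h3]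
    · intro a _ b _ hab
      simp only [Prod.mk.injEq] at hab
      funext i
      fin_cases i
      · exact hab.1
      · exact hab.2
  | succ m ih =>
    intro Φ ζ β n hζ hβ hu hp hn
    have h1 : (badF (m + 3) Φ ζ).card ≤ (badP (m + 2) Φ ζ Φ.verts).card := by
      refine card_le_card_of_injOn (fun a => (a 0, Fin.tail a)) ?_ ?_
      · intro a ha
        simp only [badF, badP, coe_filter, mem_univ, true_and, Set.mem_ofPred_eq] at ha ⊢
        obtain ⟨h1, h2⟩ := ha
        have e : insert (a 0) (univ.image (Fin.tail a)) = univ.image a := by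
          ext v
          simp [Fin.exists_fin_succ, Fin.tail, eq_comm]
        refine ⟨(hu _ h1).1 (mem_image_of_mem _ (mem_univ _)), by rwa [e], ?_⟩
        rw [List.ofFn_succ, List.tail_cons] at h2
        exact h2
      · intro a _ b _ hab
        simp only [Prod.mk.injEq] at hab
        rw [← Fin.cons_self_tail a, ← Fin.cons_self_tail b, hab.1, hab.2]
    have h2 := badP_card (m := m) hζ hu Φ.verts
    have h3 : ∀ z ∈ Φ.verts, ((badF (m + 2) (Φ.link {z}) ζ).card : ℝ) ≤
        β * n ^ m + m * ζ * n ^ (m + 2) := by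
      intro z hz
      refine ih hζ hβ (uniform_link hu z) (pairBad_link hp hz) (le_trans ?_ hn)
      exact card_le_card sdiff_subset
    have h4 := Finset.sum_le_sum h3
    rw [sum_const, nsmul_eq_mul] at h4
    have h5 : (Φ.verts.card : ℝ) ≤ n := by exact_mod_cast hn
    have h6 : (Φ.verts.card : ℝ) * (β * n ^ m + m * ζ * n ^ (m + 2)) ≤
      n * (β * n ^ m + m * ζ * n ^ (m + 2)) := by
      apply mul_le_mul_of_nonneg_right h5; positivity
    have h7 : ζ * (Φ.verts.card : ℝ) ^ (m + 3) ≤ ζ * (n : ℝ) ^ (m + 3) := by gcongr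
    have h8 : ((badF (m + 3) Φ ζ).card : ℝ) ≤ ((badP (m + 2) Φ ζ Φ.verts).card : ℝ) := by
      exact_mod_cast h1
    push_cast
    calc _ ≤ _ := h8
      _ ≤ ζ * (n : ℝ) ^ (m + 3) + n * (β * n ^ m + m * ζ * n ^ (m + 2)) := by linarith
      _ = _ := by ring

/-- the pair estimate in an `(α, α/10)`-constellation -/
lemma pairBad_of_const {r : ℕ} {Ψ : Constellation V} {α : ℝ} (hα : 0 < α)
    (h : IsAMConst (r + 2) Ψ α (α / 10)) :
    PairBad r Ψ ((Ψ.verts.card : ℝ) ^ 2 / 9) := by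
  classical
  intro x hx hxc
  obtain ⟨-, hW, hWc, hcr⟩ := h.2 x hx (by simpa using hxc)
  set n := Ψ.verts.card
  set D := Ψ.verts \ Ψ.W x with hD
  have hDc : (D.card : ℝ) = n - (Ψ.W x).card := by
    rw [hD, card_sdiff_of_subset hW, Nat.cast_sub (card_le_card hW)]
  have hWn : ((Ψ.W x).card : ℝ) ≤ n := by exact_mod_cast card_le_card hW
  have hn0 : (0 : ℝ) ≤ n := Nat.cast_nonneg _
  set P := (univ : Finset (V × V)).filter fun p =>
      insert p.1 (insert p.2 x) ∈ Ψ.edges ∧ p.2 ∉ Ψ.W x with hP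
  have h1 : (P.filter fun p => p.1 ∈ Ψ.W x).card ≤ crossCount Ψ x := by
    refine card_le_card_of_injOn (fun p => {p.1, p.2}) ?_ ?_
    · intro p hp
      simp only [hP, coe_filter, mem_filter, mem_univ, true_and, Set.mem_ofPred_eq] at hp
      obtain ⟨⟨h1, h2⟩, h3⟩ := hp
      rw [mem_coe, mem_filter]
      refine ⟨mem_link_edges.2 ?_, ⟨p.1, by simp [h3]⟩, ⟨p.2, by simp [h2]⟩⟩
      have e : x ∪ {p.1, p.2} = insert p.1 (insert p.2 x) := by
        ext v; simp only [mem_union, mem_insert, mem_singleton]; tauto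
      have hc := (h.1 _ h1).2
      refine ⟨?_, by rwa [e]⟩
      rw [← e] at hc
      change Disjoint x {p.1, p.2}
      rw [← card_union_eq_card_add_card]
      have := card_union_le x {p.1, p.2}
      have := card_le_two (a := p.1) (b := p.2)
      omega
    · intro p hp q hq hpq
      simp only [hP, coe_filter, mem_filter, mem_univ, true_and, Set.mem_ofPred_eq] at hp hq
      have a1 : p.1 ∈ ({q.1, q.2} : Finset V) := by
        have : p.1 ∈ ({p.1, p.2} : Finset V) := by simp
        rw [show ({p.1, p.2} : Finset V) = {q.1, q.2} from hpq] at this; exact this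
      have a2 : p.2 ∈ ({q.1, q.2} : Finset V) := by
        have : p.2 ∈ ({p.1, p.2} : Finset V) := by simp
        rw [show ({p.1, p.2} : Finset V) = {q.1, q.2} from hpq] at this; exact this
      simp only [mem_insert, mem_singleton] at a1 a2
      refine Prod.ext ?_ ?_
      · rcases a1 with a1 | a1
        · exact a1
        · exact absurd (a1 ▸ hp.2) hq.1.2
      · rcases a2 with a2 | a2
        · exact absurd (a2 ▸ hq.2) hp.1.2
        · exact a2
  have h2 : (P.filter fun p => ¬ p.1 ∈ Ψ.W x).card ≤ D.card ^ 2 := by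
    rw [sq, ← card_product]
    refine card_le_card ?_
    intro p hp
    simp only [hP, mem_filter, mem_univ, true_and] at hp
    obtain ⟨⟨h1, h2⟩, h3⟩ := hp
    have hv := (h.1 _ h1).1
    simp only [hD, mem_product, mem_sdiff]
    exact ⟨⟨hv (by simp), h3⟩, ⟨hv (by simp), h2⟩⟩
  have h3 := card_filter_add_card_filter_not (s := P) (fun p => p.1 ∈ Ψ.W x)
  have h4 : (P.card : ℝ) ≤ α / 10 * n ^ 2 + (D.card : ℝ) ^ 2 := by
    have : P.card ≤ crossCount Ψ x + D.card ^ 2 := by omega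
    have : (P.card : ℝ) ≤ crossCount Ψ x + (D.card : ℝ) ^ 2 := by exact_mod_cast this
    linarith
  have h5 : (D.card : ℝ) ≤ (1 / 3 - α / 2) * n := by rw [hDc]; linarith
  have h5' : (0 : ℝ) ≤ D.card := Nat.cast_nonneg _
  have h6 : (D.card : ℝ) ^ 2 ≤ ((1 / 3 - α / 2) * n) ^ 2 := by gcongr
  rcases eq_or_lt_of_le hn0 with hn | hn
  · rw [← hn] at h4 h6 ⊢; nlinarith
  have h7 : α ≤ 2 / 3 := by
    have : 0 ≤ (1 / 3 - α / 2) := by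
      by_contra hneg
      push Not at hneg
      nlinarith
    linarith
  have h8 : α / 10 + (1 / 3 - α / 2) ^ 2 ≤ 1 / 9 := by nlinarith
  calc _ ≤ _ := h4
    _ ≤ (α / 10 + (1 / 3 - α / 2) ^ 2) * (n : ℝ) ^ 2 := by nlinarith
    _ ≤ 1 / 9 * (n : ℝ) ^ 2 := by gcongr
    _ = _ := by ring

end Bad

section Main

variable {V : Type} [Fintype V] [DecidableEq V]

lemma badP_bound {s : ℕ} {Ψ : Constellation V} {ζ β : ℝ} (hζ : 0 ≤ ζ) (hβ : 0 ≤ β)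
    (hu : IsUniformConst (s + 4) Ψ) (hp : PairBad (s + 2) Ψ β) {u : V} (huv : u ∈ Ψ.verts)
    (Z : Finset V) :
    ((badP (s + 2) (Ψ.link {u}) ζ Z).card : ℝ) ≤ ζ * (Ψ.verts.card : ℝ) ^ (s + 3) +
      Z.card * (β * (Ψ.verts.card : ℝ) ^ s + s * ζ * (Ψ.verts.card : ℝ) ^ (s + 2)) := by
  classical
  have hc : (Ψ.link {u}).verts.card ≤ Ψ.verts.card := card_le_card sdiff_subset
  have hu1 : IsUniformConst (s + 3) (Ψ.link {u}) := uniform_link hu u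
  have h1 := badP_card hζ hu1 Z
  have h2 : ∀ z ∈ Z, ((badF (s + 2) ((Ψ.link {u}).link {z}) ζ).card : ℝ) ≤
      β * (Ψ.verts.card : ℝ) ^ s + s * ζ * (Ψ.verts.card : ℝ) ^ (s + 2) := by
    intro z _
    by_cases hz : z ∈ (Ψ.link {u}).verts
    · refine badF_card s hζ hβ (uniform_link hu1 z) (pairBad_link (pairBad_link hp huv) hz) ?_
      exact (card_le_card sdiff_subset).trans hc
    · have : badF (s + 2) ((Ψ.link {u}).link {z}) ζ = ∅ := by
        rw [badF, filter_eq_empty_iff]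
        rintro a _ ⟨ha, -⟩
        exact hz ((hu1 _ (mem_link_edges.1 ha).2).1 (by simp))
      rw [this]
      simp only [card_empty, Nat.cast_zero]
      positivity
  have h3 := Finset.sum_le_sum h2
  rw [sum_const, nsmul_eq_mul] at h3
  have h4 : ζ * ((Ψ.link {u}).verts.card : ℝ) ^ (s + 3) ≤ ζ * (Ψ.verts.card : ℝ) ^ (s + 3) := by
    gcongr
  linarith

lemma edge_count {k : ℕ} {Ψ : Constellation V} {α μ : ℝ} (hα : 0 ≤ α)
    (h : IsAMConst k Ψ α μ) (hn : k ≤ Ψ.verts.card) (m : ℕ) :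
    ∀ S : Finset V, S ⊆ Ψ.verts → S.card + (m + 2) = k →
    5 / 9 * ((Ψ.verts.card : ℝ) - k) ^ m * (Ψ.verts.card : ℝ) ^ 2 ≤
      ((univ.filter fun a : Fin (m + 2) → V => S ∪ univ.image a ∈ Ψ.edges).card : ℝ) := by
  induction m with
  | zero =>
    intro S hS hSc
    obtain ⟨h1, -⟩ := h.2 S hS (by omega)
    have hmaps : ∀ a ∈ (univ.filter fun a : Fin (0 + 2) → V => S ∪ univ.image a ∈ Ψ.edges),
        S ∪ univ.image a ∈ Ψ.edges.filter fun e => S ⊆ e := by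
      intro a ha
      simp only [mem_filter, mem_univ, true_and] at ha ⊢
      exact ⟨ha, subset_union_left⟩
    have h2 : 2 * (Ψ.edges.filter fun e => S ⊆ e).card ≤
        (univ.filter fun a : Fin (0 + 2) → V => S ∪ univ.image a ∈ Ψ.edges).card := by
      rw [card_eq_sum_card_fiberwise hmaps, mul_comm, ← smul_eq_mul]
      refine card_nsmul_le_sum _ _ _ ?_
      intro e he
      obtain ⟨he, hSe⟩ := mem_filter.1 he
      have hec := (h.1 _ he).2
      have hc2 : (e \ S).card = 2 := by
        rw [card_sdiff_of_subset hSe]; omega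
      obtain ⟨p, q, hpq, hpqe⟩ := card_eq_two.1 hc2
      have e1 : S ∪ {p, q} = e := by rw [← hpqe, union_sdiff_of_subset hSe]
      have e2 : S ∪ {q, p} = e := by rw [pair_comm, e1]
      have i1 : (univ.image (![p, q] : Fin 2 → V)) = {p, q} := by
        ext v; simp [Fin.exists_fin_two, eq_comm]
      have i2 : (univ.image (![q, p] : Fin 2 → V)) = {q, p} := by
        ext v; simp [Fin.exists_fin_two, eq_comm]
      refine one_lt_card.2 ⟨![p, q], ?_, ![q, p], ?_, ?_⟩
      · simp only [mem_filter, mem_univ, true_and]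
        rw [i1, e1]; exact ⟨he, rfl⟩
      · simp only [mem_filter, mem_univ, true_and]
        rw [i2, e2]; exact ⟨he, rfl⟩
      · intro hh
        exact hpq (congrFun hh 0)
    have h3 : (2 : ℝ) * ((Ψ.edges.filter fun e => S ⊆ e).card : ℝ) ≤
        ((univ.filter fun a : Fin (0 + 2) → V => S ∪ univ.image a ∈ Ψ.edges).card : ℝ) := by
      exact_mod_cast h2
    have h4 : 0 ≤ α * (Ψ.verts.card : ℝ) ^ 2 := by positivity
    rw [pow_zero]
    linarith
  | succ m ih =>
    intro S hS hSc
    set T : Finset (Σ _ : V, (Fin (m + 2) → V)) := (Ψ.verts \ S).sigma fun z =>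
      univ.filter fun a : Fin (m + 2) → V => insert z S ∪ univ.image a ∈ Ψ.edges with hT
    have h1 : T.card ≤
        (univ.filter fun a : Fin (m + 3) → V => S ∪ univ.image a ∈ Ψ.edges).card := by
      refine card_le_card_of_injOn (fun x => (Fin.cons x.1 x.2 : Fin (m + 3) → V)) ?_ ?_
      · rintro ⟨z, a⟩ hx
        simp only [hT, mem_coe, mem_sigma, mem_filter, mem_univ, true_and] at hx ⊢
        convert hx.2 using 1
        ext v
        simp only [mem_union, mem_image, mem_univ, true_and, mem_insert, Fin.exists_fin_succ (n := m + 2),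
          Fin.cons_zero, Fin.cons_succ]
        rw [eq_comm (a := z)]
        tauto
      · rintro ⟨z, a⟩ _ ⟨z', a'⟩ _ hx
        obtain ⟨rfl, rfl⟩ := Fin.cons_injective2 hx
        rfl
    rw [hT, card_sigma] at h1
    have h2 : ∀ z ∈ Ψ.verts \ S, 5 / 9 * ((Ψ.verts.card : ℝ) - k) ^ m * (Ψ.verts.card : ℝ) ^ 2 ≤
      ((univ.filter fun a : Fin (m + 2) → V => insert z S ∪ univ.image a ∈ Ψ.edges).card : ℝ) := by
      intro z hz
      obtain ⟨hz1, hz2⟩ := mem_sdiff.1 hz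
      refine ih _ (insert_subset hz1 hS) ?_
      rw [card_insert_of_notMem hz2]; omega
    have h3 := Finset.sum_le_sum h2
    rw [sum_const, nsmul_eq_mul] at h3
    have h4 : ((Ψ.verts.card : ℝ) - k) ≤ ((Ψ.verts \ S).card : ℝ) := by
      rw [card_sdiff_of_subset hS, Nat.cast_sub (card_le_card hS)]
      have : (S.card : ℝ) ≤ k := by exact_mod_cast (by omega : S.card ≤ k)
      linarith
    have h5 : (0 : ℝ) ≤ (Ψ.verts.card : ℝ) - k := by
      have : (k : ℝ) ≤ Ψ.verts.card := by exact_mod_cast hn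
      linarith
    have h6 : ((Ψ.verts.card : ℝ) - k) * (5 / 9 * ((Ψ.verts.card : ℝ) - k) ^ m * (Ψ.verts.card : ℝ) ^ 2) ≤
      ((Ψ.verts \ S).card : ℝ) * (5 / 9 * ((Ψ.verts.card : ℝ) - k) ^ m * (Ψ.verts.card : ℝ) ^ 2) := by
      gcongr
    have h7 : (∑ z ∈ Ψ.verts \ S, ((univ.filter fun a : Fin (m + 2) → V =>
        insert z S ∪ univ.image a ∈ Ψ.edges).card : ℝ)) ≤
        ((univ.filter fun a : Fin (m + 3) → V => S ∪ univ.image a ∈ Ψ.edges).card : ℝ) := by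
      exact_mod_cast h1
    calc _ = ((Ψ.verts.card : ℝ) - k) *
          (5 / 9 * ((Ψ.verts.card : ℝ) - k) ^ m * (Ψ.verts.card : ℝ) ^ 2) := by ring
      _ ≤ _ := h6.trans (h3.trans h7)

def hyb {r : ℕ} (i : ℕ) (p a : Fin r → V) : Fin r → V := fun t => if t.1 < i then a t else p t

open Classical in
noncomputable def chains {r : ℕ} (F : Finset (V × V × (Fin r → V))) (j : ℕ)
    (y : V × V × (Fin r → V)) : Finset (Fin r → V) :=
  univ.filter fun p => (∀ t : Fin r, j ≤ t.1 → p t = y.2.2 t) ∧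
    ∀ i ≤ j, (y.1, y.2.1, hyb i p y.2.2) ∈ F

lemma chains_count {r : ℕ} (F : Finset (V × V × (Fin r → V))) (U W X : Finset V) (v₀ : V)
    (hF : ∀ y ∈ F, y.1 ∈ U ∧ y.2.1 ∈ W ∧ ∀ t, y.2.2 t ∈ X) (hU : 0 < U.card) (hW : 0 < W.card)
    (hX : 0 < X.card) :
    (F.card : ℝ) * (F.card / (U.card * W.card * (X.card : ℝ) ^ (r - 1))) ^ r ≤
      ((F.sigma fun y => chains F r y).card : ℝ) := by
  classical
  rw [card_sigma, Nat.cast_sum]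
  refine sid_count F r
    (fun j y => (y.1, y.2.1, fun t => if t.1 = j then v₀ else y.2.2 t))
    _ (by positivity) ?_ (fun j y => ((chains F j y).card : ℝ)) ?_ ?_
  · intro j hj
    have hsub : F.image (fun y : V × V × (Fin r → V) =>
        (y.1, y.2.1, fun t : Fin r => if t.1 = j then v₀ else y.2.2 t)) ⊆
        U ×ˢ W ×ˢ Fintype.piFinset (fun t : Fin r => if t.1 = j then {v₀} else X) := by
      intro x hx
      obtain ⟨y, hy, rfl⟩ := mem_image.1 hx
      obtain ⟨h1, h2, h3⟩ := hF y hy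
      simp only [mem_product, Fintype.mem_piFinset]
      refine ⟨h1, h2, fun t => ?_⟩
      split_ifs
      · simp
      · exact h3 t
    have hc := card_le_card hsub
    rw [card_product, card_product, Fintype.card_piFinset] at hc
    have hprod : ∏ t : Fin r, (if t.1 = j then ({v₀} : Finset V) else X).card = X.card ^ (r - 1) := by
      rw [← Finset.mul_prod_erase univ _ (mem_univ (⟨j, hj⟩ : Fin r))]
      simp only [if_true, card_singleton, one_mul]
      rw [Finset.prod_congr rfl (g := fun _ => X.card)]
      · rw [prod_const, card_erase_of_mem (mem_univ _), card_univ, Fintype.card_fin]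
      · intro t ht
        have : t.1 ≠ j := fun h => (mem_erase.1 ht).1 (Fin.ext h)
        rw [if_neg this]
    rw [hprod, ← mul_assoc] at hc
    exact_mod_cast hc
  · intro y hy
    have : 0 < (chains F 0 y).card := by
      refine card_pos.2 ⟨y.2.2, ?_⟩
      simp only [chains, mem_filter, mem_univ, true_and, implies_true]
      intro i _
      have : hyb i y.2.2 y.2.2 = y.2.2 := by funext t; simp [hyb]
      rw [this]; exact hy
    exact_mod_cast this
  · intro j hj y hy
    have hnat : ∑ x ∈ F with ((x.1, x.2.1, fun t : Fin r => if t.1 = j then v₀ else x.2.2 t) :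
          V × V × (Fin r → V)) =
        (y.1, y.2.1, fun t : Fin r => if t.1 = j then v₀ else y.2.2 t), (chains F j x).card ≤
        (chains F (j + 1) y).card := by
      rw [← card_sigma]
      have hag : ∀ x : V × V × (Fin r → V),
          ((x.1, x.2.1, fun t : Fin r => if t.1 = j then v₀ else x.2.2 t) : V × V × (Fin r → V)) =
          (y.1, y.2.1, fun t : Fin r => if t.1 = j then v₀ else y.2.2 t) →
          x.1 = y.1 ∧ x.2.1 = y.2.1 ∧ ∀ t : Fin r, t.1 ≠ j → x.2.2 t = y.2.2 t := by
        intro x hx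
        simp only [Prod.mk.injEq] at hx
        refine ⟨hx.1, hx.2.1, fun t ht => ?_⟩
        have := congrFun hx.2.2 t
        simpa [ht] using this
      refine card_le_card_of_injOn (fun s => s.2) ?_ ?_
      · rintro ⟨x, p⟩ hx
        simp only [mem_coe, mem_sigma, mem_filter, chains, mem_univ, true_and] at hx ⊢
        obtain ⟨⟨hxF, hxy⟩, h1, h2⟩ := hx
        obtain ⟨g1, g2, g3⟩ := hag x hxy
        have h1' : ∀ t : Fin r, j + 1 ≤ t.1 → p t = y.2.2 t := by
          intro t ht
          rw [h1 t (by omega), g3 t (by omega)]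
        refine ⟨h1', fun i hi => ?_⟩
        rcases Nat.lt_or_ge j i with hij | hij
        · have : hyb i p y.2.2 = y.2.2 := by
            funext t
            simp only [hyb]
            split_ifs with ht
            · rfl
            · exact h1' t (by omega)
          rw [this]; exact hy
        · have : hyb i p y.2.2 = hyb i p x.2.2 := by
            funext t
            simp only [hyb]
            split_ifs with ht
            · exact (g3 t (by omega)).symm
            · rfl
          rw [this, ← g1, ← g2]; exact h2 i hij
      · rintro ⟨x, p⟩ hx ⟨x', p'⟩ hx' hpp
        simp only at hpp
        subst hpp
        simp only [mem_coe, mem_sigma, mem_filter, chains, mem_univ, true_and] at hx hx'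
        obtain ⟨⟨hxF, hxy⟩, h1, h2⟩ := hx
        obtain ⟨⟨hxF', hxy'⟩, h1', h2'⟩ := hx'
        obtain ⟨g1, g2, g3⟩ := hag x hxy
        obtain ⟨g1', g2', g3'⟩ := hag x' hxy'
        have : x = x' := by
          refine Prod.ext (g1.trans g1'.symm) (Prod.ext (g2.trans g2'.symm) ?_)
          funext t
          by_cases ht : t.1 = j
          · rw [← h1 t (by omega), ← h1' t (by omega)]
          · rw [g3 t ht, g3' t ht]
        rw [this]
    exact_mod_cast hnat

open Classical in
noncomputable def goodF (r : ℕ) (Ψ : Constellation V) (ζ : ℝ) (U W : Finset V) :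
    Finset (V × V × (Fin r → V)) :=
  univ.filter fun y => y.1 ∈ U ∧ y.2.1 ∈ W ∧
    insert y.1 (insert y.2.1 (univ.image y.2.2)) ∈ Ψ.edges ∧
    RightConn (r + 1) (Ψ.link {y.1}) ζ (List.ofFn y.2.2) ∧
    LeftConn (r + 1) (Ψ.link {y.2.1}) ζ (List.ofFn y.2.2)

lemma link_edge_of_insert {r : ℕ} {Ψ : Constellation V} (hu : IsUniformConst (r + 2) Ψ) {u w : V}
    {a : Fin r → V} (h : insert u (insert w (univ.image a)) ∈ Ψ.edges) :
    u ≠ w ∧ u ∉ univ.image a ∧ w ∉ univ.image a := by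
  have hc := (hu _ h).2
  have h1 : (univ.image a).card ≤ r := by
    simpa using (card_image_le (s := univ) (f := a))
  have h2 : w ∉ univ.image a := by
    intro hw
    rw [insert_eq_of_mem hw] at hc
    have := card_insert_le u (univ.image a)
    omega
  have h3 : u ∉ insert w (univ.image a) := by
    intro hw
    rw [insert_eq_of_mem hw] at hc
    have := card_insert_le w (univ.image a)
    omega
  rw [mem_insert, not_or] at h3
  exact ⟨h3.1, h3.2, h2⟩

lemma goodF_card {s : ℕ} {Ψ : Constellation V} {α ζ : ℝ} (hα : 0 < α) (hζ : 0 ≤ ζ)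
    (h : IsAMConst (s + 4) Ψ α (α / 10)) (hn : s + 4 ≤ Ψ.verts.card) (U W : Finset V)
    (hU : U ⊆ Ψ.verts) (hW : W ⊆ Ψ.verts) :
    ((U.card : ℝ) * W.card - U.card) *
        (5 / 9 * ((Ψ.verts.card : ℝ) - (s + 4 : ℕ)) ^ s * (Ψ.verts.card : ℝ) ^ 2) ≤
      ((goodF (s + 2) Ψ ζ U W).card : ℝ) +
      (U.card * (ζ * (Ψ.verts.card : ℝ) ^ (s + 3) +
        W.card * ((Ψ.verts.card : ℝ) ^ 2 / 9 * (Ψ.verts.card : ℝ) ^ s +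
          s * ζ * (Ψ.verts.card : ℝ) ^ (s + 2))) +
      W.card * (ζ * (Ψ.verts.card : ℝ) ^ (s + 3) +
        U.card * ((Ψ.verts.card : ℝ) ^ 2 / 9 * (Ψ.verts.card : ℝ) ^ s +
          s * ζ * (Ψ.verts.card : ℝ) ^ (s + 2)))) := by
  classical
  set n := Ψ.verts.card with hn_def
  have hpb : PairBad (s + 2) Ψ ((n : ℝ) ^ 2 / 9) := pairBad_of_const hα h
  have hu := h.1
  -- all edges
  set E : Finset (Σ _ : V × V, (Fin (s + 2) → V)) := ((U ×ˢ W).filter fun p => p.1 ≠ p.2).sigma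
    fun p => univ.filter fun a : Fin (s + 2) → V => {p.1, p.2} ∪ univ.image a ∈ Ψ.edges with hE
  have hEc : ((U.card : ℝ) * W.card - U.card) *
        (5 / 9 * ((n : ℝ) - (s + 4 : ℕ)) ^ s * (n : ℝ) ^ 2) ≤ E.card := by
    rw [hE, card_sigma, Nat.cast_sum]
    have h1 : ∀ p ∈ (U ×ˢ W).filter (fun p => p.1 ≠ p.2),
        5 / 9 * ((n : ℝ) - (s + 4 : ℕ)) ^ s * (n : ℝ) ^ 2 ≤
        ((univ.filter fun a : Fin (s + 2) → V => {p.1, p.2} ∪ univ.image a ∈ Ψ.edges).card : ℝ) := by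
      intro p hp
      simp only [mem_filter, mem_product] at hp
      refine edge_count hα.le h hn s {p.1, p.2} ?_ ?_
      · intro v hv
        rcases mem_insert.1 hv with rfl | hv
        · exact hU hp.1.1
        · rw [mem_singleton.1 hv]; exact hW hp.1.2
      · rw [card_pair hp.2]; omega
    refine le_trans ?_ (Finset.sum_le_sum h1)
    rw [sum_const, nsmul_eq_mul]
    have h2 : (U.card : ℝ) * W.card - U.card ≤ (((U ×ˢ W).filter fun p => p.1 ≠ p.2).card : ℝ) := by
      have h3 := card_filter_add_card_filter_not (s := U ×ˢ W) (fun p => p.1 ≠ p.2)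
      have h4 : ((U ×ˢ W).filter fun p => ¬ p.1 ≠ p.2).card ≤ U.card := by
        refine card_le_card_of_injOn Prod.fst ?_ ?_
        · intro p hp
          simp only [coe_filter, mem_product, Set.mem_ofPred_eq] at hp
          exact hp.1.1
        · intro p hp q hq hpq
          simp only [coe_filter, mem_product, Set.mem_ofPred_eq, not_not] at hp hq
          exact Prod.ext hpq (by rw [← hp.2, ← hq.2, hpq])
      rw [card_product] at h3
      have h5 : U.card * W.card ≤ ((U ×ˢ W).filter fun p => p.1 ≠ p.2).card + U.card := by omega
      have h6 : (U.card : ℝ) * W.card ≤ (((U ×ˢ W).filter fun p => p.1 ≠ p.2).card : ℝ) + U.card := by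
        exact_mod_cast h5
      linarith
    have h5 : (0 : ℝ) ≤ (n : ℝ) - (s + 4 : ℕ) := by
      have : ((s + 4 : ℕ) : ℝ) ≤ n := by exact_mod_cast hn
      linarith
    gcongr
  -- the two bad sets
  set B1 : Finset (Σ _ : V, V × (Fin (s + 2) → V)) :=
    U.sigma fun u => badP (s + 2) (Ψ.link {u}) ζ W with hB1
  set B2 : Finset (Σ _ : V, V × (Fin (s + 2) → V)) :=
    W.sigma fun w => badP (s + 2) (Ψ.link {w}) ζ U with hB2
  have hβ : (0 : ℝ) ≤ (n : ℝ) ^ 2 / 9 := by positivity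
  have hB1c : (B1.card : ℝ) ≤ U.card * (ζ * (n : ℝ) ^ (s + 3) +
        W.card * ((n : ℝ) ^ 2 / 9 * (n : ℝ) ^ s + s * ζ * (n : ℝ) ^ (s + 2))) := by
    rw [hB1, card_sigma, Nat.cast_sum]
    refine (Finset.sum_le_sum fun u huU => badP_bound hζ hβ hu hpb (hU huU) W).trans ?_
    rw [sum_const, nsmul_eq_mul]
  have hB2c : (B2.card : ℝ) ≤ W.card * (ζ * (n : ℝ) ^ (s + 3) +
        U.card * ((n : ℝ) ^ 2 / 9 * (n : ℝ) ^ s + s * ζ * (n : ℝ) ^ (s + 2))) := by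
    rw [hB2, card_sigma, Nat.cast_sum]
    refine (Finset.sum_le_sum fun u huU => badP_bound hζ hβ hu hpb (hW huU) U).trans ?_
    rw [sum_const, nsmul_eq_mul]
  -- covering
  have hcov : E.image (fun x => (x.1.1, x.1.2, x.2)) ⊆ goodF (s + 2) Ψ ζ U W ∪
      (B1.image (fun x => (x.1, x.2.1, x.2.2 ∘ Fin.rev)) ∪
        B2.image (fun x => (x.2.1, x.1, x.2.2))) := by
    intro y hy
    obtain ⟨⟨⟨u, w⟩, a⟩, hx, rfl⟩ := mem_image.1 hy
    simp only [hE, mem_sigma, mem_filter, mem_product, mem_univ, true_and] at hx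
    obtain ⟨⟨⟨huU, hwW⟩, huw⟩, hed⟩ := hx
    have hed' : insert u (insert w (univ.image a)) ∈ Ψ.edges := by
      convert hed using 1
      ext v; simp only [mem_union, mem_insert, mem_singleton]; tauto
    obtain ⟨-, hua, hwa⟩ := link_edge_of_insert (r := s + 2) hu hed'
    rw [mem_union, mem_union]
    by_cases hR : RightConn (s + 3) (Ψ.link {u}) ζ (List.ofFn a)
    · by_cases hL : LeftConn (s + 3) (Ψ.link {w}) ζ (List.ofFn a)
      · left
        simp only [goodF, mem_filter, mem_univ, true_and]
        exact ⟨huU, hwW, hed', hR, hL⟩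
      · right; right
        refine mem_image.2 ⟨⟨w, (u, a)⟩, ?_, rfl⟩
        simp only [hB2, mem_sigma, badP, mem_filter, mem_univ, true_and]
        refine ⟨hwW, huU, mem_link_edges.2 ⟨?_, ?_⟩, hL⟩
        · rw [disjoint_singleton_left, mem_insert, not_or]
          exact ⟨huw.symm, hwa⟩
        · convert hed' using 1
          ext v; simp only [mem_union, mem_insert, mem_singleton]; tauto
    · right; left
      refine mem_image.2 ⟨⟨u, (w, a ∘ Fin.rev)⟩, ?_, ?_⟩
      · have himg : univ.image (a ∘ Fin.rev) = univ.image a := by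
          ext v
          simp only [mem_image, mem_univ, true_and, Function.comp]
          constructor
          · rintro ⟨i, hi⟩; exact ⟨_, hi⟩
          · rintro ⟨i, hi⟩; exact ⟨i.rev, by rw [Fin.rev_rev]; exact hi⟩
        have hrev : List.ofFn (a ∘ Fin.rev) = (List.ofFn a).reverse := by
          apply List.ext_getElem
          · simp
          · intro i h1 h2
            simp only [List.getElem_ofFn, List.getElem_reverse, Function.comp, List.length_ofFn]
            congr 1
            apply Fin.ext
            simp only [Fin.val_rev]
            omega
        simp only [hB1, mem_sigma, badP, mem_filter, mem_univ, true_and]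
        rw [himg, hrev]
        refine ⟨huU, hwW, mem_link_edges.2 ⟨?_, ?_⟩, hR⟩
        · rw [disjoint_singleton_left, mem_insert, not_or]
          exact ⟨huw, hua⟩
        · exact hed'
      · simp only [Prod.mk.injEq, true_and]
        funext i
        simp
  have hEi : (E.image (fun x => (x.1.1, x.1.2, x.2))).card = E.card := by
    apply card_image_of_injective
    rintro ⟨⟨u, w⟩, a⟩ ⟨⟨u', w'⟩, a'⟩ hh
    simp only [Prod.mk.injEq] at hh
    obtain ⟨rfl, rfl, rfl⟩ := hh
    rfl
  have hc := card_le_card hcov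
  rw [hEi] at hc
  have hc2 := hc.trans ((card_union_le _ _).trans (Nat.add_le_add_left
    ((card_union_le _ _).trans (Nat.add_le_add card_image_le card_image_le)) _))
  have hc3 : (E.card : ℝ) ≤ (goodF (s + 2) Ψ ζ U W).card + (B1.card + B2.card) := by
    exact_mod_cast hc2
  linarith

lemma walks_inject {s : ℕ} {Ψ : Constellation V} {ζ : ℝ} (hu : IsUniformConst (s + 4) Ψ)
    (U W : Finset V) :
    ((goodF (s + 2) Ψ ζ U W).sigma fun y => chains (goodF (s + 2) Ψ ζ U W) (s + 2) y).card ≤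
    ({t : V × (Fin (2 * (s + 4) - 4) → V) × V |
              t.1 ∈ U ∧ t.2.2 ∈ W ∧ t.1 ≠ t.2.2 ∧
              IsWalk (Ψ.link {t.1, t.2.2}).edges (s + 4 - 2) (2 * (s + 4) - 4) t.2.1 ∧
              RightConn (s + 4 - 1) (Ψ.link {t.1}) ζ
                (List.ofFn (fun j : Fin (s + 4 - 2) => t.2.1 ⟨j.1, by have := j.2; omega⟩)) ∧
              LeftConn (s + 4 - 1) (Ψ.link {t.2.2}) ζ
                (List.ofFn (fun j : Fin (s + 4 - 2) =>
                  t.2.1 ⟨(s + 4 - 2) + j.1, by have := j.2; omega⟩))} :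
            Set (V × (Fin (2 * (s + 4) - 4) → V) × V)).ncard := by
  classical
  rw [← Set.ncard_coe_finset]
  set F := goodF (s + 2) Ψ ζ U W with hF
  let q : (Fin (s + 2) → V) → (Fin (s + 2) → V) → Fin (2 * (s + 4) - 4) → V := fun p a i =>
    if hi : i.1 < s + 2 then p ⟨i.1, hi⟩ else a ⟨i.1 - (s + 2), by have := i.2; omega⟩
  have hq1 : ∀ p a (i : ℕ) (hi : i < 2 * (s + 4) - 4) (hi' : i < s + 2),
      q p a ⟨i, hi⟩ = p ⟨i, hi'⟩ := by
    intro p a i hi hi'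
    simp only [q, dif_pos hi']
  have hq2 : ∀ p a (i : ℕ) (hi : i < 2 * (s + 4) - 4) (hi' : i - (s + 2) < s + 2), s + 2 ≤ i →
      q p a ⟨i, hi⟩ = a ⟨i - (s + 2), hi'⟩ := by
    intro p a i hi hi' h
    simp only [q, dif_neg (not_lt.2 h)]
  refine Set.ncard_le_ncard_of_injOn
    (fun x => ((x.1.1, q x.2 x.1.2.2, x.1.2.1) : V × (Fin (2 * (s + 4) - 4) → V) × V))
    ?_ ?_ (Set.toFinite _)
  · rintro ⟨⟨u, w, a⟩, p⟩ hx
    simp only [mem_coe, mem_sigma, chains, mem_filter, mem_univ, true_and] at hx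
    obtain ⟨hy, -, hch⟩ := hx
    have hch' : ∀ i ≤ s + 2, u ∈ U ∧ w ∈ W ∧
        insert u (insert w (univ.image (hyb i p a))) ∈ Ψ.edges ∧
        RightConn (s + 3) (Ψ.link {u}) ζ (List.ofFn (hyb i p a)) ∧
        LeftConn (s + 3) (Ψ.link {w}) ζ (List.ofFn (hyb i p a)) := by
      intro i hi
      have := hch i hi
      simpa only [hF, goodF, mem_filter, mem_univ, true_and] using this
    have h0 : hyb 0 p a = p := by funext t; simp [hyb]
    have hr : hyb (s + 2) p a = a := by funext t; simp [hyb]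
    obtain ⟨huU, hwW, he0, hR, -⟩ := hch' 0 (by omega)
    obtain ⟨-, -, -, -, hL⟩ := hch' (s + 2) le_rfl
    rw [h0] at he0 hR
    rw [hr] at hL
    have e1 : (fun j : Fin (s + 2) => q p a ⟨j.1, by have := j.2; omega⟩) = p := by
      funext j
      exact hq1 p a j.1 _ j.2
    have e2 : (fun j : Fin (s + 2) => q p a ⟨(s + 2) + j.1, by have := j.2; omega⟩) = a := by
      funext j
      rw [hq2 p a _ _ (by have := j.2; omega) (by omega)]
      congr 1
      apply Fin.ext
      simp
    refine ⟨huU, hwW, (link_edge_of_insert (r := s + 2) hu he0).1, ?_, ?_, ?_⟩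
    · intro i hi
      obtain ⟨-, -, hei, -, -⟩ := hch' i (by omega)
      have himg : univ.image (fun j : Fin (s + 2) => q p a ⟨i + j.1, by have := j.2; omega⟩) =
          univ.image (hyb i p a) := by
        ext v
        simp only [mem_image, mem_univ, true_and]
        constructor
        · rintro ⟨j, rfl⟩
          have := j.2
          by_cases hj : i + j.1 < s + 2
          · refine ⟨⟨i + j.1, hj⟩, ?_⟩
            rw [hq1 p a _ _ hj]
            simp [hyb]
          · refine ⟨⟨i + j.1 - (s + 2), by omega⟩, ?_⟩
            rw [hq2 p a _ _ (by omega) (by omega)]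
            simp only [hyb]
            rw [if_pos (by omega)]
        · rintro ⟨t, rfl⟩
          have := t.2
          by_cases ht : t.1 < i
          · refine ⟨⟨s + 2 + t.1 - i, by omega⟩, ?_⟩
            rw [hq2 p a _ _ (by simp only; omega) (by simp only; omega)]
            simp only [hyb, if_pos ht]
            congr 1
            apply Fin.ext
            simp only
            omega
          · refine ⟨⟨t.1 - i, by omega⟩, ?_⟩
            rw [hq1 p a _ _ (by simp only; omega)]
            simp only [hyb, if_neg ht]
            congr 1
            apply Fin.ext
            simp only
            omega
      have goal' : univ.image (fun j : Fin (s + 2) => q p a ⟨i + j.1, by have := j.2; omega⟩) ∈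
          (Ψ.link {u, w}).edges := by
        rw [himg]
        obtain ⟨-, g2, g3⟩ := link_edge_of_insert (r := s + 2) hu hei
        refine mem_link_edges.2 ⟨?_, ?_⟩
        · rw [disjoint_insert_left, disjoint_singleton_left]
          exact ⟨g2, g3⟩
        · convert hei using 1
          ext v; simp only [mem_union, mem_insert, mem_singleton]; tauto
      exact goal'
    · have : RightConn (s + 3) (Ψ.link {u}) ζ
          (List.ofFn (fun j : Fin (s + 2) => q p a ⟨j.1, by have := j.2; omega⟩)) := by
        rw [e1]; exact hR
      exact this
    · have : LeftConn (s + 3) (Ψ.link {w}) ζ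
          (List.ofFn (fun j : Fin (s + 2) => q p a ⟨(s + 2) + j.1, by have := j.2; omega⟩)) := by
        rw [e2]; exact hL
      exact this
  · rintro ⟨⟨u, w, a⟩, p⟩ _ ⟨⟨u', w', a'⟩, p'⟩ _ hh
    simp only [Prod.mk.injEq] at hh
    obtain ⟨rfl, hqq, rfl⟩ := hh
    have hp : p = p' := by
      funext j
      rw [← hq1 p a j.1 (by have := j.2; omega) j.2, hqq, hq1 p' a' j.1 _ j.2]
    have ha : a = a' := by
      funext j
      have hj := j.2
      have k1 := hq2 p a (s + 2 + j.1) (by omega) (by omega) (by omega)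
      have k2 := hq2 p' a' (s + 2 + j.1) (by omega) (by omega) (by omega)
      rw [hqq, k2] at k1
      have : (⟨s + 2 + j.1 - (s + 2), by omega⟩ : Fin (s + 2)) = j := Fin.ext (by simp)
      rw [this] at k1
      exact k1.symm
    rw [hp, ha]

end Main

/-- the numerical estimate -/
lemma numeric_c (s : ℕ) (ζ δ : ℝ) (hζ0 : 0 < ζ) (hζ : ζ ≤ ((3 : ℝ) ^ (s + 4 + 2))⁻¹)
    (hδ : δ = 1 / (100 * ((s : ℝ) + 4))) :
    0 ≤ 1 / 3 - 10 / 9 * δ - 2 * (s * ζ ^ 3 + ζ ^ 2) ∧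
    ζ ≤ (1 / 3 - 10 / 9 * δ - 2 * (s * ζ ^ 3 + ζ ^ 2)) ^ (s + 3) := by
  have hs : (0 : ℝ) ≤ s := Nat.cast_nonneg _
  have hk : (0 : ℝ) < (s : ℝ) + 4 := by positivity
  have h3s : (s : ℝ) + 4 ≤ 3 ^ (s + 4) := by
    have := (Nat.lt_pow_self (n := s + 4) (a := 3) (by norm_num)).le
    exact_mod_cast this
  have hkz : ((s : ℝ) + 4) * ζ ≤ 1 / 9 := by
    calc ((s : ℝ) + 4) * ζ ≤ 3 ^ (s + 4) * ((3 : ℝ) ^ (s + 4 + 2))⁻¹ := by gcongr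
      _ = 1 / 9 := by rw [pow_add _ (s + 4) 2]; field_simp; norm_num
  have hz : ζ ≤ 1 / 36 := by nlinarith
  have hkd : ((s : ℝ) + 4) * δ = 1 / 100 := by rw [hδ]; field_simp
  obtain ⟨c, hc⟩ : ∃ c, c = 1 / 3 - 10 / 9 * δ - 2 * (s * ζ ^ 3 + ζ ^ 2) := ⟨_, rfl⟩
  rw [← hc]
  have hsz : (s : ℝ) * ζ ^ 3 ≤ 1 / 9 * ζ ^ 2 := by
    have : (s : ℝ) * ζ ≤ 1 / 9 := by nlinarith
    have h2 : 0 ≤ ζ ^ 2 := by positivity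
    nlinarith
  have hz2 : ((s : ℝ) + 4) * ζ ^ 2 ≤ 1 / 324 := by nlinarith
  have hlow : ((s : ℝ) + 4) * (1 - 3 * c) ≤ 1 / 2 := by
    rw [hc]; nlinarith
  have h1c : 1 - 3 * c ≤ 1 / 8 := by nlinarith
  have hc0 : 0 ≤ c := by linarith
  refine ⟨hc0, ?_⟩
  have hb := one_add_mul_le_pow (a := 3 * c - 1) (by linarith) (s + 3)
  have h1c0 : 0 ≤ 1 - 3 * c := by
    rw [hc]
    have : 0 ≤ δ := by rw [hδ]; positivity
    have : 0 ≤ (s : ℝ) * ζ ^ 3 := by positivity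
    nlinarith
  push_cast at hb
  have hb2 : 1 / 27 ≤ (3 * c) ^ (s + 3) := by
    have e : 1 + (3 * c - 1) = 3 * c := by ring
    rw [e] at hb
    nlinarith
  rw [mul_pow] at hb2
  have h3 : (0 : ℝ) < 3 ^ (s + 3) := by positivity
  refine hζ.trans ?_
  rw [show s + 4 + 2 = s + 3 + 3 from rfl, pow_add _ (s + 3) 3, inv_le_iff_one_le_mul₀ (by positivity)]
  nlinarith

set_option maxHeartbeats 1000000 in
/-- Lemma 2.23: for `k ≥ 4`, `α > 0`, `ζ ∈ (0, 3^{-(k+2)}]` there is `n₀` such that in every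
`k`-uniform `(α, α/10)`-constellation on `n ≥ n₀` vertices and for all `U, W ⊆ V(Ψ)` with
`|U|, |W| ≥ ζ n` there are at least `ζ³ n^{2k-2}` tuples `(u, q₁, …, q_{2k-4}, w)` with
`u ∈ U`, `w ∈ W` distinct, `q₁…q_{2k-4}` a walk in `H(Ψ_{uw})`, `(q₁,…,q_{k-2})`
`ζ³`-rightconnectable in `Ψ_u`, and `(q_{k-1},…,q_{2k-4})` `ζ³`-leftconnectable in `Ψ_w`. -/
theorem stmt17 (k : ℕ) (hk : 4 ≤ k) (α ζ : ℝ) (hα : 0 < α)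
    (hζ0 : 0 < ζ) (hζ : ζ ≤ ((3 : ℝ) ^ (k + 2))⁻¹) :
    ∃ n₀ : ℕ, ∀ (V : Type) [Fintype V] [DecidableEq V] (Ψ : Constellation V),
      IsAMConst k Ψ α (α / 10) → n₀ ≤ Ψ.verts.card →
      ∀ U Wset : Finset V, U ⊆ Ψ.verts → Wset ⊆ Ψ.verts →
        ζ * (Ψ.verts.card : ℝ) ≤ (U.card : ℝ) →
        ζ * (Ψ.verts.card : ℝ) ≤ (Wset.card : ℝ) →
        ζ ^ 3 * (Ψ.verts.card : ℝ) ^ (2 * k - 2) ≤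
          (({t : V × (Fin (2 * k - 4) → V) × V |
              t.1 ∈ U ∧ t.2.2 ∈ Wset ∧ t.1 ≠ t.2.2 ∧
              IsWalk (Ψ.link {t.1, t.2.2}).edges (k - 2) (2 * k - 4) t.2.1 ∧
              RightConn (k - 1) (Ψ.link {t.1}) (ζ ^ 3)
                (List.ofFn (fun j : Fin (k - 2) => t.2.1 ⟨j.1, by have := j.2; omega⟩)) ∧
              LeftConn (k - 1) (Ψ.link {t.2.2}) (ζ ^ 3)
                (List.ofFn (fun j : Fin (k - 2) =>
                  t.2.1 ⟨(k - 2) + j.1, by have := j.2; omega⟩))} :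
            Set (V × (Fin (2 * k - 4) → V) × V)).ncard : ℝ) := by
  obtain ⟨s, rfl⟩ : ∃ s, k = s + 4 := ⟨k - 4, by omega⟩
  obtain ⟨δ, hδ⟩ : ∃ δ : ℝ, δ = 1 / (100 * ((s : ℝ) + 4)) := ⟨_, rfl⟩
  have hs : (0 : ℝ) ≤ s := Nat.cast_nonneg _
  have hδ0 : 0 < δ := by rw [hδ]; positivity
  obtain ⟨hc0, hcz⟩ := numeric_c s ζ δ hζ0 hζ hδ
  obtain ⟨c, hc⟩ : ∃ c, c = 1 / 3 - 10 / 9 * δ - 2 * (s * ζ ^ 3 + ζ ^ 2) := ⟨_, rfl⟩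
  rw [← hc] at hc0 hcz
  obtain ⟨N1, hN1⟩ := exists_nat_ge (1 / (ζ * δ))
  obtain ⟨N2, hN2⟩ := exists_nat_ge ((s : ℝ) * (s + 4) / δ)
  refine ⟨N1 + N2 + (s + 4), ?_⟩
  intro V _ _ Ψ hΨ hn U W hU hW hUc hWc
  refine le_trans ?_ (Nat.cast_le.2 (walks_inject (ζ := ζ ^ 3) hΨ.1 U W))
  have hF := goodF_card (ζ := ζ ^ 3) hα (by positivity) hΨ (by omega) U W hU hW
  obtain ⟨n, hnn⟩ : ∃ n : ℝ, n = (Ψ.verts.card : ℝ) := ⟨_, rfl⟩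
  obtain ⟨A, hA⟩ : ∃ A : ℝ, A = (U.card : ℝ) := ⟨_, rfl⟩
  obtain ⟨B, hB⟩ : ∃ B : ℝ, B = (W.card : ℝ) := ⟨_, rfl⟩
  have hnR : (N1 : ℝ) + N2 + (s + 4) ≤ n := by rw [hnn]; exact_mod_cast hn
  have hN1' : (0 : ℝ) ≤ N1 := Nat.cast_nonneg _
  have hN2' : (0 : ℝ) ≤ N2 := Nat.cast_nonneg _
  have hn0 : 0 < n := by linarith
  have hUp : 0 < U.card := by
    have : (0 : ℝ) < U.card := lt_of_lt_of_le (by rw [← hnn]; positivity) hUc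
    exact_mod_cast this
  have hWp : 0 < W.card := by
    have : (0 : ℝ) < W.card := lt_of_lt_of_le (by rw [← hnn]; positivity) hWc
    exact_mod_cast this
  have hXp : 0 < Ψ.verts.card := by omega
  obtain ⟨v₀, -⟩ := card_pos.1 hXp
  have hch := chains_count (goodF (s + 2) Ψ (ζ ^ 3) U W) U W Ψ.verts v₀ (by
    intro y hy
    simp only [goodF, mem_filter, mem_univ, true_and] at hy
    obtain ⟨h1, h2, h3, -⟩ := hy
    refine ⟨h1, h2, fun t => (hΨ.1 _ h3).1 ?_⟩
    exact mem_insert_of_mem (mem_insert_of_mem (mem_image_of_mem _ (mem_univ t)))) hUp hWp hXp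
  refine le_trans ?_ hch
  obtain ⟨f, hf⟩ : ∃ f : ℝ, f = ((goodF (s + 2) Ψ (ζ ^ 3) U W).card : ℝ) := ⟨_, rfl⟩
  rw [← hf, ← hnn, ← hA, ← hB] at hF
  rw [← hf, ← hnn, ← hA, ← hB]
  rw [← hnn, ← hA] at hUc
  rw [← hnn, ← hB] at hWc
  have hA0 : 0 < A := by rw [hA]; exact_mod_cast hUp
  have hB0 : 0 < B := by rw [hB]; exact_mod_cast hWp
  -- lower bound for `f`
  have hB1 : 1 ≤ B * δ := by
    have h1 : 1 / (ζ * δ) ≤ n := by linarith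
    rw [div_le_iff₀ (by positivity)] at h1
    have := mul_le_mul_of_nonneg_right hWc hδ0.le
    linarith
  have hpow : (1 - δ) * n ^ s ≤ (n - (s + 4 : ℕ)) ^ s := by
    have h1 : (s : ℝ) * (s + 4) / δ ≤ n := by linarith
    rw [div_le_iff₀ hδ0] at h1
    have h2 : ((s : ℝ) + 4) / n ≤ 1 := by rw [div_le_one hn0]; linarith
    have h3 := one_add_mul_le_pow (a := -(((s : ℝ) + 4) / n)) (by linarith) s
    have h4 : (s : ℝ) * (((s : ℝ) + 4) / n) ≤ δ := by
      rw [← mul_div_assoc, div_le_iff₀ hn0]; linarith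
    have h5 : (n - (s + 4 : ℕ)) ^ s = (1 + -(((s : ℝ) + 4) / n)) ^ s * n ^ s := by
      rw [← mul_pow]; congr 1; push_cast; field_simp; ring
    rw [h5]
    have h6 : 1 - δ ≤ (1 + -(((s : ℝ) + 4) / n)) ^ s := by linarith
    gcongr
  have hδ1 : δ ≤ 1 := by
    rw [hδ, div_le_one (by positivity)]; linarith
  have hfl : c * (A * B * n ^ (s + 2)) ≤ f := by
    have h1 : (A * B * (1 - δ)) * (5 / 9 * ((1 - δ) * n ^ s) * n ^ 2) ≤
        (A * B - A) * (5 / 9 * (n - (s + 4 : ℕ)) ^ s * n ^ 2) := by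
      have h2 : A * B * (1 - δ) ≤ A * B - A := by
        have := mul_le_mul_of_nonneg_left hB1 hA0.le
        linarith
      have h3 : 0 ≤ A * B * (1 - δ) := mul_nonneg (by positivity) (by linarith)
      have h4 : 0 ≤ (1 - δ) * n ^ s := mul_nonneg (by linarith) (by positivity)
      gcongr
      linarith
    have hP : 0 ≤ A * B * n ^ (s + 2) := by positivity
    have h2 : A * (ζ ^ 3 * n ^ (s + 3)) ≤ ζ ^ 2 * (A * B * n ^ (s + 2)) := by
      calc A * (ζ ^ 3 * n ^ (s + 3)) = ζ ^ 2 * (A * (ζ * n) * n ^ (s + 2)) := by ring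
        _ ≤ _ := by gcongr
    have h3 : B * (ζ ^ 3 * n ^ (s + 3)) ≤ ζ ^ 2 * (A * B * n ^ (s + 2)) := by
      calc B * (ζ ^ 3 * n ^ (s + 3)) = ζ ^ 2 * ((ζ * n) * B * n ^ (s + 2)) := by ring
        _ ≤ _ := by gcongr
    have h4 : (A * B * (1 - δ)) * (5 / 9 * ((1 - δ) * n ^ s) * n ^ 2) =
        5 / 9 * (1 - δ) ^ 2 * (A * B * n ^ (s + 2)) := by ring
    have h5 : (5 / 9 - 10 / 9 * δ) * (A * B * n ^ (s + 2)) ≤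
        5 / 9 * (1 - δ) ^ 2 * (A * B * n ^ (s + 2)) := by
      refine mul_le_mul_of_nonneg_right ?_ hP
      have e : 5 / 9 * (1 - δ) ^ 2 = 5 / 9 - 10 / 9 * δ + 5 / 9 * δ ^ 2 := by ring
      have : 0 ≤ δ ^ 2 := sq_nonneg δ
      linarith
    have h6 : A * (ζ ^ 3 * n ^ (s + 3) + B * (n ^ 2 / 9 * n ^ s + s * ζ ^ 3 * n ^ (s + 2))) =
        A * (ζ ^ 3 * n ^ (s + 3)) + (1 / 9 + s * ζ ^ 3) * (A * B * n ^ (s + 2)) := by ring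
    have h7 : B * (ζ ^ 3 * n ^ (s + 3) + A * (n ^ 2 / 9 * n ^ s + s * ζ ^ 3 * n ^ (s + 2))) =
        B * (ζ ^ 3 * n ^ (s + 3)) + (1 / 9 + s * ζ ^ 3) * (A * B * n ^ (s + 2)) := by ring
    rw [h6, h7] at hF
    rw [h4] at h1
    rw [hc]
    linarith
  have hdiv : c * n ≤ f / (A * B * n ^ (s + 2 - 1)) := by
    rw [le_div_iff₀ (by positivity), show s + 2 - 1 = s + 1 from rfl]
    calc _ = c * (A * B * n ^ (s + 2)) := by ring
      _ ≤ _ := hfl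
  have hf0 : 0 ≤ f := by rw [hf]; exact Nat.cast_nonneg _
  calc ζ ^ 3 * n ^ (2 * (s + 4) - 2)
      = ζ * ((ζ * n) * (ζ * n)) * n ^ (s + 2) * n ^ (s + 2) := by
        rw [show 2 * (s + 4) - 2 = 2 + (s + 2) + (s + 2) by omega]; ring
    _ ≤ c ^ (s + 3) * (A * B) * n ^ (s + 2) * n ^ (s + 2) := by gcongr
    _ = (c * (A * B * n ^ (s + 2))) * (c * n) ^ (s + 2) := by ring
    _ ≤ f * (f / (A * B * n ^ (s + 2 - 1))) ^ (s + 2) := by gcongr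
end
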